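/- arXiv:2603.10896 — 7 statements merged into one kernel-verified Lean document; each statement's English description precedes it below -/
import Mathlib

section
/- For every λ > 0, the total variation distance between the Poisson distribution Poi(λ) on ℕ and the law of X + 1 where X ∼ Poi(λ) satisfies d_TV(Poi(λ), Poi(λ)+1) ≤ 1/(2√λ). Equivalently, (1/2)·Σ_{k≥0} |e^{-λ}λ^k/k! − e^{-λ}λ^{k-1}/(k−1)!| ≤ 1/(2√λ), with the convention that the term λ^{k-1}/(k−1)! is 0 for k = 0. -/
open Real

theorem hasSum_poisson_weights {l : ℝ} :
    HasSum (fun k : ℕ => exp (-l) * l ^ k / (Nat.factorial k)) 1 := by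
  have h := (NormedSpace.expSeries_div_hasSum_exp l).mul_left (exp (-l))
  rw [← Real.exp_eq_exp_ℝ, ← Real.exp_add, neg_add_cancel, Real.exp_zero] at h
  simpa only [mul_div_assoc] using h

theorem poisson_weights_succ (l : ℝ) (k : ℕ) :
    ((k : ℝ) + 1) * (exp (-l) * l ^ (k + 1) / (Nat.factorial (k + 1))) =
      l * (exp (-l) * l ^ k / (Nat.factorial k)) := by
  rw [Nat.factorial_succ]
  push_cast
  field_simp
  ring

theorem hasSum_poisson_mean {l : ℝ} :
    HasSum (fun k : ℕ => (k : ℝ) * (exp (-l) * l ^ k / (Nat.factorial k))) l := by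
  have h := (hasSum_poisson_weights (l := l)).mul_left l
  refine ((hasSum_nat_add_iff' 1).1 ?_)
  simpa [poisson_weights_succ] using h

theorem hasSum_poisson_sq {l : ℝ} :
    HasSum (fun k : ℕ => (k : ℝ) ^ 2 * (exp (-l) * l ^ k / (Nat.factorial k)))
      (l * (l + 1)) := by
  have h := ((hasSum_poisson_mean (l := l)).add (hasSum_poisson_weights (l := l))).mul_left l
  refine ((hasSum_nat_add_iff' 1).1 ?_)
  simp only [Finset.range_one, Finset.sum_singleton, Nat.cast_zero, ne_eq, OfNat.ofNat_ne_zero,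
    not_false_eq_true, zero_pow, zero_mul, sub_zero]
  refine Eq.mp (congrArg (HasSum · _) (funext fun k => ?_)) h
  push_cast
  linear_combination -((k : ℝ) + 1) * poisson_weights_succ l k

/-- Total variation bound between `Poi(λ)` and `Poi(λ) + 1`:
`d_TV(Poi(λ), Poi(λ)+1) = (1/2)·Σ_k |e^{-λ}λ^k/k! − e^{-λ}λ^{k-1}/(k−1)!| ≤ 1/(2√λ)`,
with the convention that the term `λ^{k-1}/(k−1)!` is `0` for `k = 0`. -/
theorem dTV_poisson_shift_le (l : ℝ) (hl : 0 < l) :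
    (1 / 2) * ∑' k : ℕ,
      |exp (-l) * l ^ k / (Nat.factorial k) -
        (if k = 0 then 0 else exp (-l) * l ^ (k - 1) / (Nat.factorial (k - 1)))|
      ≤ 1 / (2 * Real.sqrt l) := by
  obtain ⟨s, hs, rfl⟩ : ∃ s : ℝ, 0 < s ∧ l = s ^ 2 :=
    ⟨√l, Real.sqrt_pos.2 hl, (Real.sq_sqrt hl.le).symm⟩
  rw [Real.sqrt_sq hs.le]
  -- AM-GM, `|t| ≤ (s t² + 1 / s) / 2` at `t = 1 - k / s ^ 2`, reduces to the first two moments.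
  have hsum : HasSum (fun k : ℕ => (s * (1 - k / s ^ 2) ^ 2 + 1 / s) / 2 *
      (exp (-s ^ 2) * (s ^ 2) ^ k / (Nat.factorial k))) (1 / s) := by
    have h := ((hasSum_poisson_weights (l := s ^ 2)).mul_left ((s + 1 / s) / 2)).add
      ((hasSum_poisson_mean (l := s ^ 2)).mul_left (-1 / s)) |>.add
      ((hasSum_poisson_sq (l := s ^ 2)).mul_left (1 / (2 * s ^ 3)))
    rw [show (1 / s : ℝ) = (s + 1 / s) / 2 * 1 + -1 / s * s ^ 2 +
      1 / (2 * s ^ 3) * (s ^ 2 * (s ^ 2 + 1)) by field_simp; ring]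
    refine Eq.mp (congrArg (HasSum · _) (funext fun k => ?_)) h
    field_simp
    ring
  have hle : ∀ k : ℕ, |exp (-s ^ 2) * (s ^ 2) ^ k / (Nat.factorial k) -
      (if k = 0 then 0 else exp (-s ^ 2) * (s ^ 2) ^ (k - 1) / (Nat.factorial (k - 1)))| ≤
      (s * (1 - k / s ^ 2) ^ 2 + 1 / s) / 2 *
        (exp (-s ^ 2) * (s ^ 2) ^ k / (Nat.factorial k)) := by
    intro k
    have hk : exp (-s ^ 2) * (s ^ 2) ^ k / (Nat.factorial k) -
        (if k = 0 then 0 else exp (-s ^ 2) * (s ^ 2) ^ (k - 1) / (Nat.factorial (k - 1))) =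
        (1 - k / s ^ 2) * (exp (-s ^ 2) * (s ^ 2) ^ k / (Nat.factorial k)) := by
      rcases k with _ | k
      · simp
      · have h := poisson_weights_succ (s ^ 2) k
        simp only [Nat.add_eq_zero_iff, one_ne_zero, and_false, if_false, Nat.add_sub_cancel]
        rw [sub_mul, one_mul, div_mul_eq_mul_div, Nat.cast_succ, h,
          mul_div_cancel_left₀ _ hl.ne']
    have hp : 0 ≤ exp (-s ^ 2) * (s ^ 2) ^ k / (Nat.factorial k) := by positivity
    rw [hk, abs_mul, abs_of_nonneg hp]
    refine mul_le_mul_of_nonneg_right ?_ hp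
    rw [← sq_abs (1 - k / s ^ 2 : ℝ)]
    set t := |(1 - k / s ^ 2 : ℝ)|
    have h : (s * t ^ 2 + 1 / s) / 2 - t = (s * t - 1) ^ 2 / (2 * s) := by
      field_simp
      ring
    have h_nonneg : 0 ≤ (s * t - 1) ^ 2 / (2 * s) := by positivity
    linarith
  have hsummable := Summable.of_nonneg_of_le (fun k => abs_nonneg _) hle hsum.summable
  calc _ ≤ (1 / 2) * (1 / s) :=
        mul_le_mul_of_nonneg_left (hasSum_le hle hsummable.hasSum hsum) (by norm_num)
    _ = 1 / (2 * s) := by field_simp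
end

section
/- Let 𝒳 be a countable set, x₀ ∈ 𝒳, and let Z = (Z_n)_{n≥0} be a (possibly time-inhomogeneous) Markov chain on 𝒳 started at x₀, with law P_{x₀} on 𝒳^ℕ. Suppose that for every n ≥ 0 and every x, y ∈ 𝒳 with P_{x₀}(Z_n = x) > 0 and P_{x₀}(Z_n = y) > 0, one has d_TV(P_{x₀}(Z_m ∈ · | Z_n = x), P_{x₀}(Z_m ∈ · | Z_n = y)) → 0 as m → ∞. Then every event in the tail σ-algebra 𝒯 = ∩_{n≥0} σ(Z_m : m ≥ n) has P_{x₀}-probability either 0 or 1. -/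
open MeasureTheory ProbabilityTheory Filter

/-- Total variation distance between two measures on a countable (discrete) space:
`d_TV(μ,ν) = (1/2)·Σ_x |μ({x}) − ν({x})|`. -/
noncomputable def dTV {α : Type*} [MeasurableSpace α] (μ ν : Measure α) : ℝ :=
  (1 / 2) * ∑' x : α, |(μ {x}).toReal - (ν {x}).toReal|

/-- The tail σ-algebra `𝒯 = ∩_{n≥0} σ(Z_m : m ≥ n)` on the path space `ℕ → 𝒳`. -/
def tailSigma (𝒳 : Type*) [MeasurableSpace 𝒳] : MeasurableSpace (ℕ → 𝒳) :=
  ⨅ n : ℕ, MeasurableSpace.comap (fun (w : ℕ → 𝒳) (m : ℕ) => w (n + m)) inferInstance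

/-- The initial segment of a path up to time `n`. -/
abbrev initialSegment {𝒳 : Type*} (n : ℕ) : (ℕ → 𝒳) → Finset.Iic n → 𝒳 :=
  Preorder.frestrictLe (π := fun _ => 𝒳) n

lemma measurableSet_comap_shift_of_tail {𝒳 : Type*} [MeasurableSpace 𝒳] {E : Set (ℕ → 𝒳)}
    (hE : MeasurableSet[tailSigma 𝒳] E) (n : ℕ) :
    MeasurableSet[MeasurableSpace.comap (fun (w : ℕ → 𝒳) (m : ℕ) => w (n + m))
      inferInstance] E :=
  iInf_le (fun n : ℕ => MeasurableSpace.comap (fun (w : ℕ → 𝒳) (m : ℕ) => w (n + m))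
    inferInstance) n E hE

lemma measureReal_cond_apply {Ω : Type*} [MeasurableSpace Ω] (μ : Measure Ω) {s : Set Ω}
    (hs : MeasurableSet s) (t : Set Ω) : (μ[|s]).real t = (μ.real s)⁻¹ * μ.real (s ∩ t) := by
  simp [measureReal_def, cond_apply hs]

section PathSpace

variable {𝒳 : Type*} [Countable 𝒳] [MeasurableSpace 𝒳] [DiscreteMeasurableSpace 𝒳]

/-- Finite measures on path space agreeing on all cylinders based on single points are equal. -/
lemma pathMeasure_ext {μ ν : Measure (ℕ → 𝒳)} [IsFiniteMeasure μ] [IsFiniteMeasure ν]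
    (h : ∀ (k : ℕ) (d : ℕ → 𝒳), μ {w | ∀ i ≤ k, w i = d i} = ν {w | ∀ i ≤ k, w i = d i}) :
    μ = ν := by
  have hk (k : ℕ) : μ.map (initialSegment k) = ν.map (initialSegment k) := by
    refine Measure.ext_of_singleton fun a => ?_
    rw [Measure.map_apply (by fun_prop) (measurableSet_singleton a),
      Measure.map_apply (by fun_prop) (measurableSet_singleton a)]
    rcases isEmpty_or_nonempty (ℕ → 𝒳) with he | ⟨⟨w₀⟩⟩
    · simp [Set.eq_empty_of_isEmpty]
    have key : initialSegment k ⁻¹' {a} =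
        {w | ∀ i ≤ k, w i = if hi : i ∈ Finset.Iic k then a ⟨i, hi⟩ else w₀ i} := by
      ext w
      simp only [Set.mem_preimage, Set.mem_singleton_iff, funext_iff, Set.mem_ofPred_eq,
        Subtype.forall, initialSegment, Preorder.frestrictLe_apply]
      grind
    rw [key, h]
  refine IsProjectiveLimit.unique (P := fun I => μ.map I.restrict) (fun I => rfl) fun I => ?_
  have hI : I ⊆ Finset.Iic (I.sup id) := I.subset_Iic_sup_id
  have hc : I.restrict (π := fun _ => 𝒳) =
      Finset.restrict₂ (π := fun _ => 𝒳) hI ∘ initialSegment (I.sup id) := rfl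
  change ν.map I.restrict = μ.map I.restrict
  rw [hc, ← Measure.map_map (by fun_prop) (by fun_prop), ← hk,
    Measure.map_map (by fun_prop) (by fun_prop)]

/-- The measure of a set is the sum of the measures of its slices by a discrete variable. -/
lemma hasSum_measureReal_inter_eval (μ : Measure (ℕ → 𝒳)) [IsFiniteMeasure μ] (m : ℕ)
    (A : Set (ℕ → 𝒳)) : HasSum (fun z => μ.real ({w | w m = z} ∩ A)) (μ.real A) := by
  have hmeas (z : 𝒳) : MeasurableSet {w : ℕ → 𝒳 | w m = z} :=
    (measurableSet_singleton z).preimage (measurable_pi_apply m)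
  have h : ∑' z, μ ({w | w m = z} ∩ A) = μ A := by
    have h := measure_iUnion (μ := μ.restrict A) (f := fun z : 𝒳 => {w : ℕ → 𝒳 | w m = z})
      (fun a b hab => Set.disjoint_left.2 fun w ha hb => hab (ha.symm.trans hb)) hmeas
    simp only [Measure.restrict_apply (hmeas _)] at h
    rw [← h, Set.iUnion_eq_univ_iff.2 fun w => ⟨w m, rfl⟩, Measure.restrict_apply_univ]
  rw [measureReal_def, ← h, ENNReal.tsum_toReal_eq fun _ => measure_ne_top _ _]
  exact (ENNReal.summable_toReal (h ▸ measure_ne_top μ A)).hasSum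

/-- Conditionally on the state at time `n`, the next `k` steps have the product transition
probability whatever the past. -/
lemma markov_cylinder {p : ℕ → 𝒳 → 𝒳 → ENNReal} {P : Measure (ℕ → 𝒳)}
    {χ : 𝒳 → ENNReal}
    (hP : ∀ (n : ℕ) (c : ℕ → 𝒳),
      P {w | ∀ i ≤ n, w i = c i} =
        χ (c 0) * ∏ i ∈ Finset.range n, p i (c i) (c (i + 1)))
    (n k : ℕ) (d : ℕ → 𝒳) (S : Set (Finset.Iic n → 𝒳)) :
    P (initialSegment n ⁻¹' S ∩ {w | w n = d 0} ∩ {w | ∀ i ≤ k, w (n + i) = d i}) =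
      (∏ i ∈ Finset.range k, p (n + i) (d i) (d (i + 1))) *
        P (initialSegment n ⁻¹' S ∩ {w | w n = d 0}) := by
  have hfr : Measurable (initialSegment (𝒳 := 𝒳) n) := by fun_prop
  have hn : MeasurableSet {w : ℕ → 𝒳 | w n = d 0} :=
    (measurableSet_singleton _).preimage (measurable_pi_apply n)
  have hmeas : (P.restrict ({w | w n = d 0} ∩ {w | ∀ i ≤ k, w (n + i) = d i})).map
        (initialSegment n) =
      (∏ i ∈ Finset.range k, p (n + i) (d i) (d (i + 1))) •
        (P.restrict {w | w n = d 0}).map (initialSegment n) := by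
    refine Measure.ext_of_singleton fun a => ?_
    have ha := hfr (measurableSet_singleton a)
    rw [Measure.smul_apply, Measure.map_apply hfr (measurableSet_singleton a),
      Measure.map_apply hfr (measurableSet_singleton a), Measure.restrict_apply ha,
      Measure.restrict_apply ha, smul_eq_mul]
    by_cases han : a ⟨n, by simp⟩ = d 0
    · set c : ℕ → 𝒳 := fun i => if hi : i ∈ Finset.Iic n then a ⟨i, hi⟩ else d (i - n) with hc
      have hcn (i : ℕ) : c (n + i) = d i := by
        rcases Nat.eq_zero_or_pos i with rfl | hi
        · simpa [hc] using han
        · simp [hc, hi.ne']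
      have hca (w : ℕ → 𝒳) : initialSegment n w = a ↔ ∀ i ≤ n, w i = c i := by
        simp only [funext_iff, Subtype.forall, initialSegment, Preorder.frestrictLe_apply]
        grind
      have h1 : initialSegment n ⁻¹' {a} ∩
          ({w | w n = d 0} ∩ {w | ∀ i ≤ k, w (n + i) = d i}) =
          {w | ∀ i ≤ n + k, w i = c i} := by
        ext w
        simp only [Set.mem_inter_iff, Set.mem_preimage, Set.mem_singleton_iff, hca,
          Set.mem_ofPred_eq]
        refine ⟨fun ⟨h, _, h'⟩ i hi => ?_, fun h => ⟨fun i hi => h i (by omega), ?_, ?_⟩⟩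
        · rcases le_total i n with hin | hin
          · exact h i hin
          · obtain ⟨j, rfl⟩ := Nat.exists_eq_add_of_le hin
            rw [hcn, h' j (by omega)]
        · rw [h n (by omega), ← hcn 0, add_zero]
        · exact fun i hi => by rw [h (n + i) (by omega), hcn]
      have h2 : initialSegment n ⁻¹' {a} ∩ {w | w n = d 0} =
          {w | ∀ i ≤ n, w i = c i} := by
        ext w
        simp only [Set.mem_inter_iff, Set.mem_preimage, Set.mem_singleton_iff, hca,
          Set.mem_ofPred_eq, and_iff_left_iff_imp]
        exact fun h => by rw [h n le_rfl, ← hcn 0, add_zero]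
      rw [h1, h2, hP, hP, Finset.prod_range_add]
      simp only [add_assoc, hcn]
      ring
    · have h2 : initialSegment n ⁻¹' {a} ∩ {w | w n = d 0} = ∅ := by
        ext w
        simp only [Set.mem_inter_iff, Set.mem_preimage, Set.mem_singleton_iff,
          Set.mem_ofPred_eq, Set.mem_empty_iff_false, iff_false]
        rintro ⟨rfl, h⟩
        exact han h
      rw [← Set.inter_assoc, h2]
      simp
  have h := congrArg (fun μ => μ S) hmeas
  have hS : MeasurableSet S := S.to_countable.measurableSet
  simpa only [Measure.smul_apply, Measure.map_apply hfr hS, Measure.restrict_apply (hfr hS),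
    smul_eq_mul, ← Set.inter_assoc] using h

/-- The Markov property: past and future are conditionally independent given the present. -/
lemma markov_property {p : ℕ → 𝒳 → 𝒳 → ENNReal} {P : Measure (ℕ → 𝒳)}
    [IsFiniteMeasure P] {χ : 𝒳 → ENNReal}
    (hP : ∀ (n : ℕ) (c : ℕ → 𝒳),
      P {w | ∀ i ≤ n, w i = c i} =
        χ (c 0) * ∏ i ∈ Finset.range n, p i (c i) (c (i + 1)))
    (n : ℕ) (x : 𝒳) (S : Set (Finset.Iic n → 𝒳)) {E : Set (ℕ → 𝒳)}
    (hE : MeasurableSet[MeasurableSpace.comap (fun (w : ℕ → 𝒳) (m : ℕ) => w (n + m))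
      inferInstance] E) :
    P.real {w | w n = x} * P.real (initialSegment n ⁻¹' S ∩ {w | w n = x} ∩ E) =
      P.real (initialSegment n ⁻¹' S ∩ {w | w n = x}) * P.real ({w | w n = x} ∩ E) := by
  obtain ⟨B, hB, rfl⟩ := hE
  have hT : Measurable (fun (w : ℕ → 𝒳) (m : ℕ) => w (n + m)) := by fun_prop
  have hcyl (k : ℕ) (d : ℕ → 𝒳) : MeasurableSet {w : ℕ → 𝒳 | ∀ i ≤ k, w i = d i} := by
    measurability
  have hm : (P {w | w n = x}).toNNReal • (P.restrict (initialSegment n ⁻¹' S ∩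
        {w | w n = x})).map (fun (w : ℕ → 𝒳) (m : ℕ) => w (n + m)) =
      (P (initialSegment n ⁻¹' S ∩ {w | w n = x})).toNNReal •
        (P.restrict {w | w n = x}).map (fun (w : ℕ → 𝒳) (m : ℕ) => w (n + m)) := by
    refine pathMeasure_ext fun k d => ?_
    simp only [Measure.smul_apply, Measure.map_apply hT (hcyl k d),
      Measure.restrict_apply (hT (hcyl k d)), ENNReal.smul_def, smul_eq_mul,
      ENNReal.coe_toNNReal (measure_ne_top P _)]
    rw [Set.preimage_ofPred_eq]
    by_cases hx : d 0 = x
    · subst hx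
      have h1 := markov_cylinder hP n k d S
      have h2 := markov_cylinder hP n k d Set.univ
      simp only [Set.preimage_univ, Set.univ_inter] at h2
      rw [Set.inter_comm, h1, Set.inter_comm {a : ℕ → 𝒳 | ∀ i ≤ k, a (n + i) = d i}, h2]
      ring
    · have h0 : {w : ℕ → 𝒳 | ∀ i ≤ k, w (n + i) = d i} ∩ {w | w n = x} = ∅ := by
        ext w
        simp only [Set.mem_inter_iff, Set.mem_ofPred_eq, Set.mem_empty_iff_false, iff_false]
        rintro ⟨h, rfl⟩
        exact hx (h 0 (Nat.zero_le _)).symm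
      rw [Set.inter_comm (initialSegment n ⁻¹' S), ← Set.inter_assoc, h0]
      simp
  have h := congrArg (fun μ => (μ B).toReal) hm
  simp only [Measure.smul_apply, Measure.map_apply hT hB, Measure.restrict_apply (hT hB),
    ENNReal.smul_def, smul_eq_mul, ENNReal.coe_toNNReal (measure_ne_top P _),
    ENNReal.toReal_mul] at h
  simpa only [measureReal_def, Set.inter_comm _ ((fun (w : ℕ → 𝒳) (m : ℕ) => w (n + m)) ⁻¹' B)]
    using h

/-- Conditional probabilities of a tail event, given two states at time `n`, differ by at most
twice the total variation distance between the conditional laws at any later time. -/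
lemma abs_cond_tail_sub_le {p : ℕ → 𝒳 → 𝒳 → ENNReal} {P : Measure (ℕ → 𝒳)}
    [IsFiniteMeasure P] {χ : 𝒳 → ENNReal}
    (hP : ∀ (n : ℕ) (c : ℕ → 𝒳),
      P {w | ∀ i ≤ n, w i = c i} =
        χ (c 0) * ∏ i ∈ Finset.range n, p i (c i) (c (i + 1)))
    {E : Set (ℕ → 𝒳)} (hE : MeasurableSet[tailSigma 𝒳] E) {n m : ℕ} (hnm : n ≤ m) (x y : 𝒳) :
    |(P[|{w | w n = x}]).real E - (P[|{w | w n = y}]).real E| ≤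
      2 * dTV ((P[|{w | w n = x}]).map (fun w => w m))
        ((P[|{w | w n = y}]).map (fun w => w m)) := by
  have hmeas (k : ℕ) (z : 𝒳) : MeasurableSet {w : ℕ → 𝒳 | w k = z} :=
    (measurableSet_singleton z).preimage (measurable_pi_apply k)
  set h : 𝒳 → ℝ := fun z => (P[|{w | w m = z}]).real E
  have h_nonneg (z : 𝒳) : 0 ≤ h z := measureReal_nonneg
  have h_le (z : 𝒳) : h z ≤ 1 := measureReal_le_one
  set q : 𝒳 → 𝒳 → ℝ := fun x z => (((P[|{w | w n = x}]).map (fun w => w m)) {z}).toReal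
  have hq (x z : 𝒳) : q x z = (P[|{w | w n = x}]).real ({w | w m = z} ∩ Set.univ) := by
    rw [Set.inter_univ]
    simp only [q]
    rw [Measure.map_apply (by fun_prop) (measurableSet_singleton z)]
    rfl
  have hq_summable (x : 𝒳) : Summable (q x) := by
    simp only [funext (hq x)]
    exact (hasSum_measureReal_inter_eval _ m Set.univ).summable
  have hsum (x : 𝒳) : HasSum (fun z => q x z * h z) ((P[|{w | w n = x}]).real E) := by
    convert! hasSum_measureReal_inter_eval (P[|{w | w n = x}]) m E using 2 with z
    have hmk := markov_property hP m z ((fun a => a ⟨n, by simpa using hnm⟩) ⁻¹' {x})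
      (measurableSet_comap_shift_of_tail hE m)
    have hpre : initialSegment m ⁻¹'
        ((fun a : Finset.Iic m → 𝒳 => a ⟨n, by simpa using hnm⟩) ⁻¹' {x}) =
        {w : ℕ → 𝒳 | w n = x} := rfl
    rw [hpre] at hmk
    rw [hq, Set.inter_univ, measureReal_cond_apply P (hmeas n x), measureReal_cond_apply P (hmeas n x)]
    simp only [h]
    rw [measureReal_cond_apply P (hmeas m z), ← Set.inter_assoc]
    by_cases hz : P.real {w | w m = z} = 0
    · have h0 : P.real ({w | w n = x} ∩ {w | w m = z} ∩ E) = 0 :=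
        measureReal_mono_null (fun w hw => hw.1.2) hz
      simp [hz, h0]
    · field_simp
      linear_combination -(P.real {w | w n = x})⁻¹ * hmk
  have hd : Summable fun z => |q x z - q y z| := ((hq_summable x).sub (hq_summable y)).abs
  have hb (z : 𝒳) : |q x z * h z - q y z * h z| ≤ |q x z - q y z| := by
    rw [← sub_mul, abs_mul, abs_of_nonneg (h_nonneg z)]
    exact mul_le_of_le_one_right (abs_nonneg _) (h_le z)
  have hs := (hsum x).sub (hsum y)
  rw [← hs.tsum_eq]
  have h2 : 2 * dTV ((P[|{w | w n = x}]).map (fun w => w m))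
      ((P[|{w | w n = y}]).map (fun w => w m)) = ∑' z, |q x z - q y z| := by
    simp only [dTV, q]
    ring
  rw [h2]
  exact tsum_of_norm_bounded (f := fun z => q x z * h z - q y z * h z) hd.hasSum hb

end PathSpace

open Classical in
/-- Let `Z` be a (possibly time-inhomogeneous) Markov chain on a countable state space `𝒳`
started at `x₀`, with law `P` on path space. If for all `n` and all `x, y` with
`P(Z_n = x) > 0`, `P(Z_n = y) > 0` the total variation distance between
`P(Z_m ∈ · | Z_n = x)` and `P(Z_m ∈ · | Z_n = y)` tends to `0` as `m → ∞`, then every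
tail event has probability `0` or `1`. -/
theorem tail_triviality_of_dTV_tendsto_zero
    {𝒳 : Type*} [Countable 𝒳] [MeasurableSpace 𝒳] [DiscreteMeasurableSpace 𝒳]
    (x₀ : 𝒳) (p : ℕ → 𝒳 → 𝒳 → ENNReal)
    (hstoch : ∀ n x, ∑' y : 𝒳, p n x y = 1)
    (P : Measure (ℕ → 𝒳)) [IsProbabilityMeasure P]
    (hP : ∀ (n : ℕ) (c : ℕ → 𝒳),
      P {w | ∀ i ≤ n, w i = c i} =
        (if c 0 = x₀ then 1 else 0) * ∏ i ∈ Finset.range n, p i (c i) (c (i + 1)))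
    (hconv : ∀ (n : ℕ) (x y : 𝒳),
      P {w | w n = x} ≠ 0 → P {w | w n = y} ≠ 0 →
      Tendsto (fun m : ℕ =>
          dTV ((P[|{w | w n = x}]).map (fun w => w m))
              ((P[|{w | w n = y}]).map (fun w => w m)))
        atTop (nhds 0))
    (E : Set (ℕ → 𝒳)) (hE : MeasurableSet[tailSigma 𝒳] E) :
    P E = 0 ∨ P E = 1 := by
  have hmeas (k : ℕ) (z : 𝒳) : MeasurableSet {w : ℕ → 𝒳 | w k = z} :=
    (measurableSet_singleton z).preimage (measurable_pi_apply k)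
  have hEm : MeasurableSet E := by
    obtain ⟨B, hB, rfl⟩ := measurableSet_comap_shift_of_tail hE 0
    exact (show Measurable fun (w : ℕ → 𝒳) (m : ℕ) => w (0 + m) by fun_prop) hB
  have hcond (n : ℕ) (x y : 𝒳) (hx : P {w | w n = x} ≠ 0) (hy : P {w | w n = y} ≠ 0) :
      (P[|{w | w n = x}]).real E = (P[|{w | w n = y}]).real E := by
    have hlim := (hconv n x y hx hy).const_mul 2
    rw [mul_zero] at hlim
    have hle := ge_of_tendsto hlim
      (eventually_atTop.2 ⟨n, fun m hm =>
        abs_cond_tail_sub_le (χ := fun a => if a = x₀ then 1 else 0) hP hE hm x y⟩)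
    exact sub_eq_zero.1 (abs_nonpos_iff.1 hle)
  have hindep (n : ℕ) (x : 𝒳) : P.real ({w | w n = x} ∩ E) = P.real {w | w n = x} * P.real E := by
    have hcross (y : 𝒳) : P.real ({w | w n = y} ∩ Set.univ) * P.real ({w | w n = x} ∩ E) =
        P.real {w | w n = x} * P.real ({w | w n = y} ∩ E) := by
      rw [Set.inter_univ]
      have hnull (z : 𝒳) (hz : P.real {w | w n = z} = 0) : P.real ({w | w n = z} ∩ E) = 0 :=
        measureReal_mono_null Set.inter_subset_left hz
      by_cases hx : P.real {w | w n = x} = 0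
      · rw [hx, hnull x hx]
        simp
      by_cases hy : P.real {w | w n = y} = 0
      · rw [hy, hnull y hy]
        simp
      have hxy := hcond n x y (fun h => hx (by simp [measureReal_def, h]))
        (fun h => hy (by simp [measureReal_def, h]))
      rw [measureReal_cond_apply P (hmeas n x), measureReal_cond_apply P (hmeas n y)] at hxy
      field_simp at hxy
      linear_combination hxy
    have h1 := (hasSum_measureReal_inter_eval P n Set.univ).mul_right (P.real ({w | w n = x} ∩ E))
    simp only [hcross] at h1
    have h2 := (hasSum_measureReal_inter_eval P n E).mul_left (P.real {w | w n = x})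
    simpa using h1.unique h2
  have hprod : P.restrict E = (P E).toNNReal • P := by
    refine pathMeasure_ext fun n c => ?_
    have hC : MeasurableSet {w : ℕ → 𝒳 | ∀ i ≤ n, w i = c i} := by measurability
    rw [Measure.restrict_apply hC, Measure.smul_apply, ENNReal.smul_def, smul_eq_mul,
      ENNReal.coe_toNNReal (measure_ne_top P _),
      ← ENNReal.toReal_eq_toReal_iff' (by finiteness) (by finiteness), ENNReal.toReal_mul]
    have hmk := markov_property (χ := fun a => if a = x₀ then 1 else 0) hP n (c n)
      {a | ∀ i : Finset.Iic n, a i = c i} (measurableSet_comap_shift_of_tail hE n)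
    have hpre : initialSegment n ⁻¹' {a : Finset.Iic n → 𝒳 | ∀ i, a i = c i} ∩
        {w | w n = c n} = {w | ∀ i ≤ n, w i = c i} := by
      ext w
      simp only [Set.mem_inter_iff, Set.mem_preimage, Set.mem_ofPred_eq, Subtype.forall,
        initialSegment, Preorder.frestrictLe_apply, Finset.mem_Iic]
      grind
    rw [hpre, hindep] at hmk
    change P.real _ = P.real _ * P.real _
    by_cases h0 : P.real {w | w n = c n} = 0
    · have h1 : P.real {w | ∀ i ≤ n, w i = c i} = 0 :=
        measureReal_mono_null (fun w hw => hw n le_rfl) h0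
      rw [h1, mul_zero]
      exact measureReal_mono_null Set.inter_subset_left h1
    · refine mul_left_cancel₀ h0 ?_
      linear_combination hmk
  have hsq := congrArg (fun μ => μ E) hprod
  simp only [Measure.restrict_apply hEm, Set.inter_self, Measure.smul_apply, ENNReal.smul_def,
    smul_eq_mul, ENNReal.coe_toNNReal (measure_ne_top P _)] at hsq
  refine or_iff_not_imp_left.2 fun h0 => ?_
  exact ((ENNReal.mul_eq_left h0 (measure_ne_top P E)).1 hsq.symm)
end

section
/- Let 𝒳 be a countable set, x₀ ∈ 𝒳, and let Z = (Z_n)_{n≥0} be a (possibly time-inhomogeneous) Markov chain on 𝒳 started at x₀, with law P_{x₀} on 𝒳^ℕ. Suppose every event in the tail σ-algebra 𝒯 = ∩_{n≥0} σ(Z_m : m ≥ n) has P_{x₀}-probability either 0 or 1. Then for every n ≥ 0 and every x, y ∈ 𝒳 with P_{x₀}(Z_n = x) > 0 and P_{x₀}(Z_n = y) > 0, one has d_TV(P_{x₀}(Z_m ∈ · | Z_n = x), P_{x₀}(Z_m ∈ · | Z_n = y)) → 0 as m → ∞. -/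
open MeasureTheory ProbabilityTheory Filter

/-- Orthogonal projections onto a decreasing sequence of subspaces converge strongly, and the limit
lies in all of the subspaces. -/
theorem exists_tendsto_starProjection_of_antitone {E : Type*} [NormedAddCommGroup E]
    [InnerProductSpace ℝ E] [CompleteSpace E] (K : ℕ → Submodule ℝ E)
    [∀ k, (K k).HasOrthogonalProjection] (hK : Antitone K) (a : E) :
    ∃ b : E, (∀ k, b ∈ K k) ∧ Tendsto (fun k => (K k).starProjection a) atTop (nhds b) := by
  have hmono : Monotone fun k => (K k)ᗮ := fun i j hij => Submodule.orthogonal_le (hK hij)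
  have hlim := Submodule.starProjection_tendsto_closure_iSup (fun k => (K k)ᗮ) hmono a
  have hlim' : Tendsto (fun k => (K k).starProjection a) atTop
      (nhds (a - (⨆ k, (K k)ᗮ).topologicalClosure.starProjection a)) := by
    refine (hlim.const_sub a).congr fun k => ?_
    simp [Submodule.starProjection_orthogonal]
  refine ⟨_, fun k => ?_, hlim'⟩
  have hclosed : IsClosed (K k : Set E) := by
    rw [← Submodule.orthogonal_orthogonal (K k)]
    exact Submodule.isClosed_orthogonal _
  refine hclosed.mem_of_tendsto hlim' ?_
  filter_upwards [eventually_ge_atTop k] with j hj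
  exact hK hj (Submodule.starProjection_apply_mem _ _)

/-- A function measurable up to null sets for each σ-algebra of a decreasing sequence, whose
intersection is trivial, is almost everywhere constant. -/
theorem exists_ae_eq_const_of_iInf_trivial {Ω : Type*} {m0 : MeasurableSpace Ω} {P : Measure Ω}
    [IsProbabilityMeasure P] {m : ℕ → MeasurableSpace Ω} (hanti : Antitone m)
    (htriv : ∀ E : Set Ω, MeasurableSet[⨅ k, m k] E → P E = 0 ∨ P E = 1)
    (hm : ∀ k, m k ≤ m0) {f : Ω → ℝ} (hf : ∀ k, AEStronglyMeasurable[m k] f P) :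
    ∃ c : ℝ, f =ᵐ[P] fun _ => c := by
  choose g hgm hfg using hf
  refine Filter.exists_eventuallyEq_const_of_forall_separating MeasurableSet fun s hs => ?_
  set E : Set Ω := limsup (fun k => g k ⁻¹' s) atTop with hE
  have hEm : MeasurableSet[⨅ k, m k] E := by
    rw [MeasurableSpace.measurableSet_iInf]
    intro j
    rw [hE, ← limsup_nat_add _ j]
    exact @MeasurableSet.measurableSet_limsup _ (m j) _ fun k =>
      hanti (Nat.le_add_left j k) _ ((hgm (k + j)).measurable hs)
  have hfE : ∀ᵐ w ∂P, w ∈ E ↔ f w ∈ s := by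
    filter_upwards [ae_all_iff.2 hfg] with w hw
    simp [hE, mem_limsup_iff_frequently_mem, ← hw]
  have hE0 : MeasurableSet E := iInf_le_of_le 0 (hm 0) _ hEm
  rcases htriv E hEm with h | h
  · right
    filter_upwards [hfE, measure_eq_zero_iff_ae_notMem.1 h] with w h1 h2
    exact fun h3 => h2 (h1.2 h3)
  · left
    filter_upwards [hfE, (mem_ae_iff_prob_eq_one hE0).2 h] with w h1 h2
    exact h1.1 h2

/-- Lévy's downward theorem in `L¹` for square-integrable functions and a trivial limit
σ-algebra. -/
theorem tendsto_integral_abs_condExp_sub_of_iInf_trivial {Ω : Type*} {m0 : MeasurableSpace Ω}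
    {P : Measure Ω} [IsProbabilityMeasure P] {m : ℕ → MeasurableSpace Ω} (hanti : Antitone m)
    (htriv : ∀ E : Set Ω, MeasurableSet[⨅ k, m k] E → P E = 0 ∨ P E = 1)
    (hm : ∀ k, m k ≤ m0) {f : Ω → ℝ} (hf : MemLp f 2 P) :
    Tendsto (fun k => ∫ w, |P[f | m k] w - ∫ v, f v ∂P| ∂P) atTop (nhds 0) := by
  have : ∀ k, Fact (m k ≤ m0) := fun k => ⟨hm k⟩
  obtain ⟨b, hb, hlim⟩ := exists_tendsto_starProjection_of_antitone
    (fun k => lpMeas ℝ ℝ (m k) 2 P)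
    (fun i j hij g hg => mem_lpMeas_iff_aestronglyMeasurable.2
      ((mem_lpMeas_iff_aestronglyMeasurable.1 hg).mono (hanti hij))) hf.toLp
  obtain ⟨c, hc⟩ := exists_ae_eq_const_of_iInf_trivial hanti htriv hm
    fun k => mem_lpMeas_iff_aestronglyMeasurable.1 (hb k)
  have hint : ∀ k, Integrable (fun w => P[f | m k] w - c) P := fun k =>
    integrable_condExp.sub (integrable_const c)
  have hbound : ∀ k, ∫ w, |P[f | m k] w - c| ∂P ≤
      ‖(lpMeas ℝ ℝ (m k) 2 P).starProjection hf.toLp - b‖ := by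
    intro k
    have hae : (fun w => P[f | m k] w - c) =ᵐ[P]
        ((lpMeas ℝ ℝ (m k) 2 P).starProjection hf.toLp - b : Lp ℝ 2 P) := by
      filter_upwards [hf.condExpL2_ae_eq_condExp (𝕜 := ℝ) (hm k), hc, Lp.coeFn_sub
        ((lpMeas ℝ ℝ (m k) 2 P).starProjection hf.toLp) b] with w h1 h2 h3
      rw [h3, Pi.sub_apply, h2, ← h1]
      rfl
    rw [Lp.norm_def, ← eLpNorm_congr_ae hae]
    have h1 := eLpNorm_le_eLpNorm_of_exponent_le (μ := P) one_le_two (hint k).aestronglyMeasurable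
    have h2 : eLpNorm (fun w => P[f | m k] w - c) 2 P ≠ ⊤ := by
      rw [eLpNorm_congr_ae hae]
      exact Lp.eLpNorm_ne_top _
    refine le_trans (le_of_eq ?_) (ENNReal.toReal_mono h2 h1)
    rw [eLpNorm_one_eq_lintegral_enorm, ← integral_norm_eq_lintegral_enorm
      (hint k).aestronglyMeasurable]
    rfl
  have hzero : Tendsto (fun k => ∫ w, |P[f | m k] w - c| ∂P) atTop (nhds 0) :=
    squeeze_zero (fun k => integral_nonneg fun w => abs_nonneg _) hbound
      (tendsto_iff_norm_sub_tendsto_zero.1 hlim)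
  have hcf : |∫ v, f v ∂P - c| ≤ 0 := by
    refine ge_of_tendsto' hzero fun k => ?_
    have : ∫ v, f v ∂P - c = ∫ w, (P[f | m k] w - c) ∂P := by
      rw [integral_sub integrable_condExp (integrable_const c), integral_condExp (hm k)]
      simp
    rw [this]
    exact abs_integral_le_integral_abs
  rw [sub_eq_zero.1 (abs_nonpos_iff.1 hcf)]
  exact hzero

/-- The law of a discrete random variable `Z` on an event `A` is close to a multiple of its law as
soon as the conditional probability of `A` given a σ-algebra making `Z` measurable is close to
that constant. -/
theorem summable_and_tsum_abs_measureReal_inter_sub_le {Ω α : Type*} [Countable α]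
    [MeasurableSpace α] [DiscreteMeasurableSpace α] {m m0 : MeasurableSpace Ω} (hm : m ≤ m0)
    {P : Measure Ω} [IsProbabilityMeasure P] {A : Set Ω} (hA : MeasurableSet A) {Z : Ω → α}
    (hZ : Measurable[m] Z) (c : ℝ) :
    (Summable fun z => |P.real (A ∩ Z ⁻¹' {z}) - c * P.real (Z ⁻¹' {z})|) ∧
    ∑' z, |P.real (A ∩ Z ⁻¹' {z}) - c * P.real (Z ⁻¹' {z})| ≤
      ∫ w, |P[A.indicator (fun _ => (1 : ℝ)) | m] w - c| ∂P := by
  have hAint : Integrable (A.indicator fun _ => (1 : ℝ)) P := (integrable_const 1).indicator hA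
  have hint : Integrable (fun w => P[A.indicator (fun _ => (1 : ℝ)) | m] w - c) P :=
    integrable_condExp.sub (integrable_const c)
  have hZm : ∀ z, MeasurableSet[m] (Z ⁻¹' {z}) := fun z => hZ (measurableSet_singleton z)
  have hunion : (⋃ z, Z ⁻¹' {z}) = Set.univ := by
    ext w
    simp
  have hsum := hasSum_integral_iUnion (μ := P) (s := fun z => Z ⁻¹' {z})
    (f := fun w => |P[A.indicator (fun _ => (1 : ℝ)) | m] w - c|) (fun z => hm _ (hZm z))
    (fun i j hij => Set.disjoint_left.2 fun w h1 h2 => hij (h1.symm.trans h2))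
    hint.abs.integrableOn
  rw [hunion, setIntegral_univ] at hsum
  have hle : ∀ z, |P.real (A ∩ Z ⁻¹' {z}) - c * P.real (Z ⁻¹' {z})| ≤
      ∫ w in Z ⁻¹' {z}, |P[A.indicator (fun _ => (1 : ℝ)) | m] w - c| ∂P := by
    intro z
    have : P.real (A ∩ Z ⁻¹' {z}) - c * P.real (Z ⁻¹' {z}) =
        ∫ w in Z ⁻¹' {z}, (P[A.indicator (fun _ => (1 : ℝ)) | m] w - c) ∂P := by
      rw [integral_sub integrable_condExp.integrableOn (integrable_const c).integrableOn,
        setIntegral_condExp hm hAint (hZm z), integral_indicator_const _ hA]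
      simp [measureReal_restrict_apply hA, mul_comm]
    rw [this]
    exact abs_integral_le_integral_abs
  have hs := Summable.of_nonneg_of_le (fun z => abs_nonneg _) hle hsum.summable
  exact ⟨hs, (hs.tsum_le_tsum hle hsum.summable).trans_eq hsum.tsum_eq⟩

/-- The total variation distance between the laws of a discrete random variable conditioned on two
events is controlled by the conditional probabilities of these events. -/
theorem dTV_map_cond_le {Ω α : Type*} [Countable α] [MeasurableSpace α]
    [DiscreteMeasurableSpace α] {m m0 : MeasurableSpace Ω} (hm : m ≤ m0) {P : Measure Ω}
    [IsProbabilityMeasure P] {A B : Set Ω} (hA : MeasurableSet A) (hB : MeasurableSet B)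
    (hA0 : P A ≠ 0) (hB0 : P B ≠ 0) {Z : Ω → α} (hZ : Measurable[m] Z) :
    dTV ((P[|A]).map Z) ((P[|B]).map Z) ≤ (1 / 2) *
      ((P.real A)⁻¹ * ∫ w, |P[A.indicator (fun _ => (1 : ℝ)) | m] w - P.real A| ∂P +
        (P.real B)⁻¹ * ∫ w, |P[B.indicator (fun _ => (1 : ℝ)) | m] w - P.real B| ∂P) := by
  have hZ0 : Measurable Z := hZ.mono hm le_rfl
  have hlaw : ∀ {C : Set Ω}, MeasurableSet C → P C ≠ 0 → ∀ z,
      |(((P[|C]).map Z) {z}).toReal - P.real (Z ⁻¹' {z})| =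
        (P.real C)⁻¹ * |P.real (C ∩ Z ⁻¹' {z}) - P.real C * P.real (Z ⁻¹' {z})| := by
    intro C hC hC0 z
    have hpos : 0 < P.real C := ENNReal.toReal_pos hC0 (measure_ne_top _ _)
    rw [Measure.map_apply hZ0 (measurableSet_singleton z), cond_apply hC, ENNReal.toReal_mul,
      ENNReal.toReal_inv, ← measureReal_def, ← measureReal_def,
      ← abs_of_pos (inv_pos.2 hpos), ← abs_mul, abs_of_pos (inv_pos.2 hpos), mul_sub,
      inv_mul_cancel_left₀ hpos.ne']
  obtain ⟨hsA, htA⟩ := summable_and_tsum_abs_measureReal_inter_sub_le hm hA hZ (P.real A)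
    (P := P)
  obtain ⟨hsB, htB⟩ := summable_and_tsum_abs_measureReal_inter_sub_le hm hB hZ (P.real B)
    (P := P)
  have hle : ∀ z, |(((P[|A]).map Z) {z}).toReal - (((P[|B]).map Z) {z}).toReal| ≤
      (P.real A)⁻¹ * |P.real (A ∩ Z ⁻¹' {z}) - P.real A * P.real (Z ⁻¹' {z})| +
        (P.real B)⁻¹ * |P.real (B ∩ Z ⁻¹' {z}) - P.real B * P.real (Z ⁻¹' {z})| := by
    intro z
    rw [← hlaw hA hA0, ← hlaw hB hB0, abs_sub_comm (((P[|B]).map Z) {z}).toReal]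
    exact abs_sub_le _ _ _
  have hsum := (hsA.mul_left (P.real A)⁻¹).add (hsB.mul_left (P.real B)⁻¹)
  unfold dTV
  gcongr
  calc _ ≤ _ := (Summable.of_nonneg_of_le (fun z => abs_nonneg _) hle hsum).tsum_le_tsum hle hsum
    _ = _ := by
      rw [(hsA.mul_left _).tsum_add (hsB.mul_left _), tsum_mul_left, tsum_mul_left]
    _ ≤ _ := by gcongr

open Classical in
/-- Let `Z` be a (possibly time-inhomogeneous) Markov chain on a countable state space `𝒳`
started at `x₀`, with law `P` on path space. If every tail event has probability `0` or `1`
under `P`, then for all `n` and all `x, y` with `P(Z_n = x) > 0`, `P(Z_n = y) > 0`, the total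
variation distance between `P(Z_m ∈ · | Z_n = x)` and `P(Z_m ∈ · | Z_n = y)` tends to `0` as
`m → ∞`. -/
theorem dTV_tendsto_zero_of_tail_triviality
    {𝒳 : Type*} [Countable 𝒳] [MeasurableSpace 𝒳] [DiscreteMeasurableSpace 𝒳]
    (x₀ : 𝒳) (p : ℕ → 𝒳 → 𝒳 → ENNReal)
    (hstoch : ∀ n x, ∑' y : 𝒳, p n x y = 1)
    (P : Measure (ℕ → 𝒳)) [IsProbabilityMeasure P]
    (hP : ∀ (n : ℕ) (c : ℕ → 𝒳),
      P {w | ∀ i ≤ n, w i = c i} =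
        (if c 0 = x₀ then 1 else 0) * ∏ i ∈ Finset.range n, p i (c i) (c (i + 1)))
    (htail : ∀ E : Set (ℕ → 𝒳), MeasurableSet[tailSigma 𝒳] E → P E = 0 ∨ P E = 1)
    (n : ℕ) (x y : 𝒳)
    (hx : P {w | w n = x} ≠ 0) (hy : P {w | w n = y} ≠ 0) :
    Tendsto (fun m : ℕ =>
        dTV ((P[|{w | w n = x}]).map (fun w => w m))
            ((P[|{w | w n = y}]).map (fun w => w m)))
      atTop (nhds 0) := by
  let G : ℕ → MeasurableSpace (ℕ → 𝒳) := fun k =>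
    MeasurableSpace.comap (fun (w : ℕ → 𝒳) (j : ℕ) => w (k + j)) inferInstance
  have hG : ∀ k, G k ≤ MeasurableSpace.pi := fun k =>
    Measurable.comap_le (measurable_pi_lambda _ fun j => measurable_pi_apply (k + j))
  have hcoord : ∀ k j, k ≤ j → Measurable[G k] fun w : ℕ → 𝒳 => w j := by
    intro k j hkj
    obtain ⟨i, rfl⟩ := Nat.exists_eq_add_of_le hkj
    exact (measurable_pi_apply i).comp
      (comap_measurable (fun (w : ℕ → 𝒳) (j : ℕ) => w (k + j)))
  have hanti : Antitone G := fun k l hkl =>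
    Measurable.comap_le (@measurable_pi_lambda _ _ _ (G k) _ _ fun j =>
      hcoord k (l + j) (hkl.trans (Nat.le_add_right l j)))
  have hmeas : ∀ z : 𝒳, MeasurableSet {w : ℕ → 𝒳 | w n = z} := fun z =>
    (measurable_pi_apply n : Measurable fun w : ℕ → 𝒳 => w n) (measurableSet_singleton z)
  have hlim : ∀ z : 𝒳, Tendsto (fun k => ∫ w,
      |P[{w : ℕ → 𝒳 | w n = z}.indicator (fun _ => (1 : ℝ)) | G k] w -
        P.real {w | w n = z}| ∂P) atTop (nhds 0) := by
    intro z
    have h := tendsto_integral_abs_condExp_sub_of_iInf_trivial hanti htail hG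
      (memLp_indicator_const (μ := P) 2 (hmeas z) (1 : ℝ) (Or.inr (measure_ne_top _ _)))
    simpa [integral_indicator_const _ (hmeas z)] using h
  refine squeeze_zero
    (fun k => mul_nonneg (by norm_num) (tsum_nonneg fun z => abs_nonneg _))
    (fun k => dTV_map_cond_le (hG k) (hmeas x) (hmeas y) hx hy (hcoord k k le_rfl)) ?_
  have h := (((hlim x).const_mul (P.real {w | w n = x})⁻¹).add
    ((hlim y).const_mul (P.real {w | w n = y})⁻¹)).const_mul (1 / 2)
  simpa using h
end

section
/- For each n ≥ 1 let 𝒳_n be a finite set, ν_n a finite measure on 𝒳_n, and π_n a probability measure on 𝒳_n. Then d_TV(PPP(ν_n) ⊕ π_n, PPP(ν_n)) → 0 as n → ∞ if and only if for every ε > 0, Σ_{x∈𝒳_n} max(π_n({x}) − ε·ν_n({x}), 0) → 0 as n → ∞. -/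
open MeasureTheory ProbabilityTheory

/-- `PPP(ν)`: the law on `ℕ^𝒳` of a Poisson point process on the finite set `𝒳` with
intensity measure `ν`; the coordinates are independent and the coordinate at `x` is
Poisson with mean `ν({x})`. -/
noncomputable def PPP {𝒳 : Type*} [Fintype 𝒳] [MeasurableSpace 𝒳] (ν : Measure 𝒳) :
    Measure (𝒳 → ℕ) :=
  Measure.pi (fun x : 𝒳 => poissonMeasure ((ν {x}).toNNReal))

open Classical in
/-- `PPP(ν) ⊕ π`: the law of `N + δ_Y` where `N ∼ PPP(ν)` and `Y ∼ π` are independent. -/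
noncomputable def PPPplus {𝒳 : Type*} [Fintype 𝒳] [MeasurableSpace 𝒳]
    (ν : Measure 𝒳) (π : Measure 𝒳) : Measure (𝒳 → ℕ) :=
  ((PPP ν).prod π).map (fun q => fun x => q.1 x + if x = q.2 then 1 else 0)

lemma hasSum_measureReal_singleton_mul {α : Type*} [MeasurableSpace α] [Countable α]
    [MeasurableSingletonClass α] (μ : Measure α) {f : α → ℝ} (hf : Integrable f μ) :
    HasSum (fun a => μ.real {a} * f a) (∫ a, f a ∂μ) := by
  have h : Integrable f (Measure.sum fun a => μ {a} • Measure.dirac a) := by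
    rwa [Measure.sum_smul_dirac]
  have h' := hasSum_integral_measure h
  rw [Measure.sum_smul_dirac] at h'
  simpa [integral_smul_measure, measureReal_def] using h'

lemma hasSum_measureReal_singleton {α : Type*} [MeasurableSpace α] [Countable α]
    [MeasurableSingletonClass α] (μ : Measure α) [IsProbabilityMeasure μ] :
    HasSum (fun a => μ.real {a}) 1 := by
  simpa using hasSum_measureReal_singleton_mul μ (integrable_const (1 : ℝ))

lemma abs_measureReal_sub_le_two_mul_dTV {α : Type*} [MeasurableSpace α] [Countable α]
    [MeasurableSingletonClass α] (μ ν : Measure α) [IsProbabilityMeasure μ]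
    [IsProbabilityMeasure ν] (s : Set α) :
    |μ.real s - ν.real s| ≤ 2 * dTV μ ν := by
  have hs : MeasurableSet s := s.to_countable.measurableSet
  have key (ρ : Measure α) [IsProbabilityMeasure ρ] :
      HasSum (fun a => ρ.real {a} * s.indicator (fun _ => (1 : ℝ)) a) (ρ.real s) := by
    simpa [integral_indicator_const, hs] using
      hasSum_measureReal_singleton_mul ρ ((integrable_const (1 : ℝ)).indicator hs)
  have hd := (key μ).sub (key ν)
  have hsum : Summable fun a => |μ.real {a} - ν.real {a}| :=
    ((hasSum_measureReal_singleton μ).sub (hasSum_measureReal_singleton ν)).summable.abs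
  have hle (a : α) : |μ.real {a} * s.indicator (fun _ => (1 : ℝ)) a
      - ν.real {a} * s.indicator (fun _ => (1 : ℝ)) a| ≤ |μ.real {a} - ν.real {a}| := by
    by_cases ha : a ∈ s <;> simp [ha]
  have h2 : 2 * dTV μ ν = ∑' a, |μ.real {a} - ν.real {a}| := by
    simp only [dTV, measureReal_def]; ring
  rw [h2, ← hd.tsum_eq, ← Real.norm_eq_abs]
  exact tsum_of_norm_bounded hsum.hasSum hle

lemma integral_abs_sub_integral_le_sqrt_variance {Ω : Type*} [MeasurableSpace Ω]
    {μ : Measure Ω} [IsProbabilityMeasure μ] {X : Ω → ℝ} (hX : MemLp X 2 μ) :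
    ∫ ω, |X ω - μ[X]| ∂μ ≤ √(Var[X; μ]) := by
  have hY : MemLp (fun ω => |X ω - μ[X]|) 2 μ := (hX.sub (memLp_const _)).norm
  have h0 := variance_nonneg (fun ω => |X ω - μ[X]|) μ
  rw [variance_eq_sub hY] at h0
  rw [variance_eq_integral hX.aemeasurable]
  apply Real.le_sqrt_of_sq_le
  simpa [sq_abs] using h0

lemma hasSum_poisson_mul_id (r : NNReal) :
    HasSum (fun n : ℕ => Real.exp (-r) * r ^ n / (n.factorial : ℝ) * n) r := by
  rw [← hasSum_nat_add_iff' 1]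
  convert! (hasSum_one_poissonMeasure r).mul_left (r : ℝ) using 1
  · ext n
    rw [Nat.factorial_succ]
    push_cast
    field_simp
    ring
  · simp

lemma hasSum_poisson_mul_sq (r : NNReal) :
    HasSum (fun n : ℕ => Real.exp (-r) * r ^ n / (n.factorial : ℝ) * (n : ℝ) ^ 2)
      ((r : ℝ) * (r + 1)) := by
  rw [← hasSum_nat_add_iff' 1]
  convert! ((hasSum_poisson_mul_id r).add (hasSum_one_poissonMeasure r)).mul_left (r : ℝ) using 1
  · ext n
    rw [Nat.factorial_succ]
    push_cast
    field_simp
    ring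
  · simp

lemma memLp_two_natCast_poissonMeasure (r : NNReal) :
    MemLp (fun n : ℕ => (n : ℝ)) 2 (poissonMeasure r) := by
  rw [memLp_two_iff_integrable_sq .of_discrete, integrable_poissonMeasure_iff]
  simpa using (hasSum_poisson_mul_sq r).summable

lemma integral_natCast_poissonMeasure (r : NNReal) :
    ∫ n : ℕ, (n : ℝ) ∂poissonMeasure r = r := by
  rw [integral_poissonMeasure]
  simpa using (hasSum_poisson_mul_id r).tsum_eq

lemma variance_natCast_poissonMeasure (r : NNReal) :
    Var[fun n : ℕ => (n : ℝ); poissonMeasure r] = r := by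
  rw [variance_eq_sub (memLp_two_natCast_poissonMeasure r), integral_natCast_poissonMeasure,
    integral_poissonMeasure]
  have := (hasSum_poisson_mul_sq r).tsum_eq
  simp only [smul_eq_mul, Pi.pow_apply]
  rw [this]
  ring

section PoissonProcess

variable {𝒳 : Type*} [Fintype 𝒳] [MeasurableSpace 𝒳]

instance isProbabilityMeasure_PPP (ν : Measure 𝒳) : IsProbabilityMeasure (PPP ν) := by
  unfold PPP; infer_instance

lemma PPP_real_singleton (ν : Measure 𝒳) (N : 𝒳 → ℕ) :
    (PPP ν).real {N} = ∏ x, (poissonMeasure (ν {x}).toNNReal).real {N x} := by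
  rw [measureReal_def, PPP, Measure.pi_singleton, ENNReal.toReal_prod]
  rfl

lemma poissonMeasure_real_singleton_succ (r : NNReal) (n : ℕ) :
    (n + 1) * (poissonMeasure r).real {n + 1} = r * (poissonMeasure r).real {n} := by
  rw [poissonMeasure_real_singleton, poissonMeasure_real_singleton, Nat.factorial_succ]
  push_cast
  field_simp
  ring

open Classical in
lemma intensity_mul_PPP_real_shift (ν : Measure 𝒳) (y : 𝒳) (N : 𝒳 → ℕ) :
    (ν {y}).toReal * (PPP ν).real {M | (fun x => M x + if x = y then 1 else 0) = N} =
      N y * (PPP ν).real {N} := by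
  rcases hN : N y with _ | k
  · have : {M : 𝒳 → ℕ | (fun x => M x + if x = y then 1 else 0) = N} = ∅ := by
      ext M
      simp only [Set.mem_ofPred_eq, Set.mem_empty_iff_false, iff_false]
      intro h
      have := congrFun h y
      simp [hN] at this
    simp [this]
  · have : {M : 𝒳 → ℕ | (fun x => M x + if x = y then 1 else 0) = N} =
        {Function.update N y k} := by
      ext M
      simp only [Set.mem_ofPred_eq, Set.mem_singleton_iff, funext_iff]
      refine forall_congr' fun x => ?_
      by_cases hx : x = y
      · subst hx; simp [hN]
      · simp [hx]
    rw [this, PPP_real_singleton, PPP_real_singleton,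
      ← Finset.mul_prod_erase _ _ (Finset.mem_univ y), ← Finset.mul_prod_erase _ _ (Finset.mem_univ y), Function.update_self, hN, ← mul_assoc,
      ← mul_assoc]
    have h := poissonMeasure_real_singleton_succ (ν {y}).toNNReal k
    congr 1
    · push_cast
      exact h.symm
    · refine Finset.prod_congr rfl fun x hx => ?_
      rw [Function.update_of_ne (Finset.ne_of_mem_erase hx)]

open Classical in
lemma PPP_real_forall_eq_zero (ν : Measure 𝒳) (A : Finset 𝒳) :
    (PPP ν).real {N | ∀ x ∈ A, N x = 0} = Real.exp (-∑ x ∈ A, (ν {x}).toReal) := by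
  have : {N : 𝒳 → ℕ | ∀ x ∈ A, N x = 0} =
      Set.univ.pi fun x => if x ∈ A then {0} else Set.univ := by
    ext N
    simp only [Set.mem_ofPred_eq, Set.mem_pi, Set.mem_univ, true_imp_iff]
    refine forall_congr' fun x => ?_
    by_cases hx : x ∈ A <;> simp [hx]
  rw [this, measureReal_def, PPP, Measure.pi_pi, ENNReal.toReal_prod, ← Finset.sum_neg_distrib,
    Real.exp_sum, ← Finset.prod_subset A.subset_univ]
  · refine Finset.prod_congr rfl fun x hx => ?_
    rw [if_pos hx, ← measureReal_def, poissonMeasure_real_singleton]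
    simp [ENNReal.coe_toNNReal_eq_toReal]
  · intro x _ hx
    simp [hx]

lemma integral_abs_sum_mul_sub_le_sqrt (ν : Measure 𝒳) (r : 𝒳 → ℝ) :
    Integrable (fun N : 𝒳 → ℕ => |∑ x, r x * (N x - (ν {x}).toReal)|) (PPP ν) ∧
    ∫ N : 𝒳 → ℕ, |∑ x, r x * (N x - (ν {x}).toReal)| ∂PPP ν ≤
      √(∑ x, r x ^ 2 * (ν {x}).toReal) := by
  have hm (x : 𝒳) : MemLp (fun n : ℕ => r x * (n : ℝ)) 2 (poissonMeasure (ν {x}).toNNReal) :=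
    (memLp_two_natCast_poissonMeasure _).const_mul _
  have hm' (x : 𝒳) : MemLp (fun N : 𝒳 → ℕ => r x * (N x : ℝ)) 2 (PPP ν) :=
    (hm x).comp_measurePreserving (measurePreserving_eval _ x)
  have hY : MemLp (∑ x, fun N : 𝒳 → ℕ => r x * (N x : ℝ)) 2 (PPP ν) :=
    memLp_finsetSum' _ fun x _ => hm' x
  have hint (x : 𝒳) : ∫ N : 𝒳 → ℕ, r x * (N x : ℝ) ∂PPP ν = r x * (ν {x}).toReal := by
    rw [integral_const_mul, PPP,
      integral_comp_eval (μ := fun x : 𝒳 => poissonMeasure (ν {x}).toNNReal) (i := x)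
        (f := fun n : ℕ => (n : ℝ)) .of_discrete, integral_natCast_poissonMeasure]
    rfl
  have hE : (PPP ν)[∑ x, fun N : 𝒳 → ℕ => r x * (N x : ℝ)] = ∑ x, r x * (ν {x}).toReal := by
    simp only [Finset.sum_apply]
    rw [integral_finsetSum _ fun x _ => (hm' x).integrable (by norm_num)]
    simp_rw [hint]
  have hV : Var[∑ x, fun N : 𝒳 → ℕ => r x * (N x : ℝ); PPP ν] =
      ∑ x, r x ^ 2 * (ν {x}).toReal := by
    rw [PPP, variance_sum_pi hm]
    refine Finset.sum_congr rfl fun x _ => ?_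
    rw [variance_const_mul, variance_natCast_poissonMeasure]
    rfl
  have heq : (fun N : 𝒳 → ℕ => |∑ x, r x * (N x - (ν {x}).toReal)|) = fun N =>
      |(∑ x, fun N : 𝒳 → ℕ => r x * (N x : ℝ)) N
        - (PPP ν)[∑ x, fun N : 𝒳 → ℕ => r x * (N x : ℝ)]| := by
    ext N
    rw [hE, Finset.sum_apply, ← Finset.sum_sub_distrib]
    simp_rw [mul_sub]
  rw [heq, ← hV]
  exact ⟨((hY.integrable (by norm_num)).sub (integrable_const _)).abs,
    integral_abs_sub_integral_le_sqrt_variance hY⟩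

variable [DiscreteMeasurableSpace 𝒳]

open Classical in
lemma measurable_PPPplus_map :
    Measurable fun q : (𝒳 → ℕ) × 𝒳 => fun x => q.1 x + if x = q.2 then 1 else 0 :=
  measurable_of_countable _

instance isProbabilityMeasure_PPPplus (ν π : Measure 𝒳) [IsProbabilityMeasure π] :
    IsProbabilityMeasure (PPPplus ν π) :=
  Measure.isProbabilityMeasure_map measurable_PPPplus_map.aemeasurable

open Classical in
lemma PPPplus_real_apply (ν π : Measure 𝒳) [IsProbabilityMeasure π] (s : Set (𝒳 → ℕ)) :
    (PPPplus ν π).real s =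
      ∑ y, (π {y}).toReal * (PPP ν).real {M : 𝒳 → ℕ | (fun x => M x + if x = y then 1 else 0) ∈ s} := by
  have hs : MeasurableSet s := s.to_countable.measurableSet
  rw [measureReal_def, PPPplus, Measure.map_apply measurable_PPPplus_map hs,
    Measure.prod_apply_symm (measurable_PPPplus_map hs), lintegral_fintype, ENNReal.toReal_sum]
  · refine Finset.sum_congr rfl fun y _ => ?_
    rw [ENNReal.toReal_mul, mul_comm]
    rfl
  · intro y _
    finiteness

lemma sum_toReal_singleton (π : Measure 𝒳) [IsProbabilityMeasure π] :
    ∑ x, (π {x}).toReal = 1 := by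
  have := hasSum_measureReal_singleton π
  exact (hasSum_fintype _).unique this

lemma exp_mul_sum_le_two_mul_dTV (ν π : Measure 𝒳) [IsProbabilityMeasure π] (A : Finset 𝒳) :
    Real.exp (-∑ x ∈ A, (ν {x}).toReal) * ∑ x ∈ A, (π {x}).toReal ≤
      2 * dTV (PPPplus ν π) (PPP ν) := by
  classical
  refine le_trans ?_ (abs_measureReal_sub_le_two_mul_dTV (PPPplus ν π) (PPP ν)
    {N | ∀ x ∈ A, N x = 0})
  rw [← PPP_real_forall_eq_zero, PPPplus_real_apply]
  set c := (PPP ν).real {N | ∀ x ∈ A, N x = 0}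
  have h (y : 𝒳) : (π {y}).toReal * (PPP ν).real
      {M : 𝒳 → ℕ | (fun x => M x + if x = y then 1 else 0) ∈ {N : 𝒳 → ℕ | ∀ x ∈ A, N x = 0}} =
      if y ∈ A then 0 else (π {y}).toReal * c := by
    split_ifs with hy
    · have : {M : 𝒳 → ℕ | (fun x => M x + if x = y then 1 else 0) ∈
          {N : 𝒳 → ℕ | ∀ x ∈ A, N x = 0}} = ∅ := by
        ext M
        simp only [Set.mem_ofPred_eq, Set.mem_empty_iff_false, iff_false]
        intro h
        simpa using h y hy
      rw [this, measureReal_empty, mul_zero]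
    · have : {M : 𝒳 → ℕ | (fun x => M x + if x = y then 1 else 0) ∈
          {N : 𝒳 → ℕ | ∀ x ∈ A, N x = 0}} = {N : 𝒳 → ℕ | ∀ x ∈ A, N x = 0} := by
        ext M
        simp only [Set.mem_ofPred_eq]
        refine forall₂_congr fun x hx => ?_
        have hxy : x ≠ y := fun e => hy (e ▸ hx)
        rw [if_neg hxy, add_zero]
      rw [this]
  simp_rw [h]
  have h1 : c * ∑ x ∈ A, (π {x}).toReal = ∑ x, if x ∈ A then (π {x}).toReal * c else 0 := by
    rw [Finset.sum_ite_mem, Finset.univ_inter, Finset.mul_sum]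
    simp_rw [mul_comm]
  have h2 : (∑ x, if x ∈ A then (π {x}).toReal * c else 0) +
      (∑ x, if x ∈ A then 0 else (π {x}).toReal * c) = c := by
    rw [← Finset.sum_add_distrib]
    calc _ = ∑ x, (π {x}).toReal * c := by
          refine Finset.sum_congr rfl fun x _ => ?_
          split_ifs <;> simp
      _ = c := by rw [← Finset.sum_mul, sum_toReal_singleton, one_mul]
  rw [h1, abs_sub_comm]
  exact le_trans (by linarith) (le_abs_self _)

lemma sum_max_sub_le_exp_mul_dTV (ν π : Measure 𝒳) [IsProbabilityMeasure π] {ε : ℝ}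
    (hε : 0 < ε) :
    ∑ x, max ((π {x}).toReal - ε * (ν {x}).toReal) 0 ≤
      Real.exp (1 / ε) * (2 * dTV (PPPplus ν π) (PPP ν)) := by
  classical
  set A := Finset.univ.filter fun x => ε * (ν {x}).toReal < (π {x}).toReal with hA
  have hS : ∑ x, max ((π {x}).toReal - ε * (ν {x}).toReal) 0 ≤ ∑ x ∈ A, (π {x}).toReal := by
    rw [hA, Finset.sum_filter]
    refine Finset.sum_le_sum fun x _ => ?_
    have : 0 ≤ ε * (ν {x}).toReal := by positivity
    split_ifs with h
    · exact max_le (by linarith) ENNReal.toReal_nonneg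
    · exact max_le (by linarith) le_rfl
  have hν : ∑ x ∈ A, (ν {x}).toReal ≤ 1 / ε := by
    rw [le_div_iff₀' hε, Finset.mul_sum]
    calc ∑ x ∈ A, ε * (ν {x}).toReal ≤ ∑ x ∈ A, (π {x}).toReal :=
          Finset.sum_le_sum fun x hx => (Finset.mem_filter.1 hx).2.le
      _ ≤ ∑ x, (π {x}).toReal :=
          Finset.sum_le_sum_of_subset_of_nonneg A.subset_univ fun _ _ _ => ENNReal.toReal_nonneg
      _ = 1 := sum_toReal_singleton π
  have hd := exp_mul_sum_le_two_mul_dTV ν π A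
  have hp : 0 ≤ ∑ x ∈ A, (π {x}).toReal := Finset.sum_nonneg fun _ _ => ENNReal.toReal_nonneg
  calc _ ≤ ∑ x ∈ A, (π {x}).toReal := hS
    _ = Real.exp (1 / ε) * (Real.exp (-(1 / ε)) * ∑ x ∈ A, (π {x}).toReal) := by
        rw [← mul_assoc, ← Real.exp_add]; simp
    _ ≤ Real.exp (1 / ε) * (Real.exp (-∑ x ∈ A, (ν {x}).toReal) * ∑ x ∈ A, (π {x}).toReal) := by
        gcongr
    _ ≤ _ := by gcongr

lemma two_mul_dTV_le (ν π : Measure 𝒳) [IsProbabilityMeasure π] {ε : ℝ}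
    (hε : 0 < ε) :
    2 * dTV (PPPplus ν π) (PPP ν) ≤
      2 * ∑ x, max ((π {x}).toReal - ε * (ν {x}).toReal) 0 + √ε := by
  classical
  set l : 𝒳 → ℝ := fun x => (ν {x}).toReal
  set p : 𝒳 → ℝ := fun x => (π {x}).toReal
  set t : 𝒳 → ℝ := fun x => max (p x - ε * l x) 0
  set r : 𝒳 → ℝ := fun x => (p x - t x) / l x
  set g : 𝒳 → (𝒳 → ℕ) → ℝ := fun y N =>
    (PPP ν).real {M | (fun x => M x + if x = y then 1 else 0) = N}
  set f : (𝒳 → ℕ) → ℝ := fun N => (PPP ν).real {N}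
  have hl0 (x) : 0 ≤ l x := ENNReal.toReal_nonneg
  have hp0 (x) : 0 ≤ p x := ENNReal.toReal_nonneg
  have ht0 (x) : 0 ≤ t x := le_max_right _ _
  have htp (x) : t x ≤ p x := max_le (by have := mul_nonneg hε.le (hl0 x); linarith) (hp0 x)
  have htl (x) : p x - t x ≤ ε * l x := by have := le_max_left (p x - ε * l x) 0; linarith
  have hrl (x) : r x * l x = p x - t x := by
    rcases eq_or_ne (l x) 0 with h | h
    · have h1 := htl x
      have h2 := htp x
      rw [h] at h1 ⊢
      linarith
    · exact div_mul_cancel₀ _ h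
  have hrε (x) : r x ≤ ε := div_le_of_le_mul₀ (hl0 x) hε.le (htl x)
  have hp1 : ∑ x, p x = 1 := sum_toReal_singleton π
  have hgf (x N) : l x * g x N = N x * f N := intensity_mul_PPP_real_shift ν x N
  have hQ (N) : (PPPplus ν π).real {N} = ∑ x, p x * g x N := PPPplus_real_apply ν π {N}
  have hgs (x) : HasSum (g x) 1 := by
    have hm : Measurable fun M : 𝒳 → ℕ => fun z => M z + if z = x then 1 else 0 :=
      measurable_of_countable _
    have := Measure.isProbabilityMeasure_map (μ := PPP ν) hm.aemeasurable
    have hgN : g x = fun N => ((PPP ν).map fun M z => M z + if z = x then 1 else 0).real {N} := by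
      ext N
      rw [map_measureReal_apply hm (measurableSet_singleton N)]
      rfl
    rw [hgN]
    exact hasSum_measureReal_singleton _
  have hfs : HasSum f 1 := hasSum_measureReal_singleton (PPP ν)
  obtain ⟨hZi, hZ⟩ := integral_abs_sum_mul_sub_le_sqrt ν r
  have hZs := hasSum_measureReal_singleton_mul (PPP ν) hZi
  have hbound := ((hasSum_sum fun x (_ : x ∈ Finset.univ) => (hgs x).mul_left (t x)).add
    (hfs.mul_left (∑ x, t x))).add hZs
  have hle (N) : ‖|(PPPplus ν π).real {N} - (PPP ν).real {N}|‖ ≤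
      ∑ x, t x * g x N + (∑ x, t x) * f N + f N * |∑ x, r x * (N x - l x)| := by
    have hf0 : 0 ≤ f N := measureReal_nonneg
    have key : (PPPplus ν π).real {N} - (PPP ν).real {N} =
        ∑ x, t x * g x N - (∑ x, t x) * f N + f N * ∑ x, r x * (N x - l x) := by
      have h1 : f N = (∑ x, p x) * f N := by rw [hp1, one_mul]
      change (PPPplus ν π).real {N} - f N = _
      rw [hQ]
      conv_lhs => rw [h1]
      rw [Finset.sum_mul, Finset.sum_mul, Finset.mul_sum, ← Finset.sum_sub_distrib,
        ← Finset.sum_sub_distrib, ← Finset.sum_add_distrib]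
      refine Finset.sum_congr rfl fun x _ => ?_
      linear_combination (-(g x N) + f N) * hrl x + r x * hgf x N
    have hA : 0 ≤ ∑ x, t x * g x N :=
      Finset.sum_nonneg fun x _ => mul_nonneg (ht0 x) measureReal_nonneg
    have hB : 0 ≤ (∑ x, t x) * f N := mul_nonneg (Finset.sum_nonneg fun x _ => ht0 x) hf0
    rw [norm_abs_eq_norm, Real.norm_eq_abs, key]
    calc _ ≤ |∑ x, t x * g x N - (∑ x, t x) * f N| + |f N * ∑ x, r x * (N x - l x)| :=
          abs_add_le _ _
      _ ≤ _ := by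
          rw [abs_mul, abs_of_nonneg hf0]
          gcongr
          exact abs_sub_le_iff.2 ⟨by linarith, by linarith⟩
  have h2 : 2 * dTV (PPPplus ν π) (PPP ν) =
      ∑' N, |(PPPplus ν π).real {N} - (PPP ν).real {N}| := by
    simp only [dTV, measureReal_def]; ring
  have hfin := tsum_of_norm_bounded hbound hle
  have hV : ∑ x, r x ^ 2 * l x ≤ ε := by
    calc ∑ x, r x ^ 2 * l x ≤ ∑ x, ε * p x := by
          refine Finset.sum_le_sum fun x _ => ?_
          calc r x ^ 2 * l x = r x * (p x - t x) := by rw [← hrl]; ring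
            _ ≤ ε * p x := mul_le_mul (hrε x) (by linarith [ht0 x]) (by linarith [htp x]) hε.le
      _ = ε := by rw [← Finset.mul_sum, hp1, mul_one]
  rw [h2]
  calc _ ≤ ‖∑' N, |(PPPplus ν π).real {N} - (PPP ν).real {N}|‖ := Real.le_norm_self _
    _ ≤ _ := hfin
    _ ≤ 2 * ∑ x, t x + √ε := by
        have := hZ.trans (Real.sqrt_le_sqrt hV)
        simp only [mul_one]
        linarith

end PoissonProcess

lemma dTV_nonneg {α : Type*} [MeasurableSpace α] (μ ν : Measure α) : 0 ≤ dTV μ ν :=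
  mul_nonneg (by norm_num) (tsum_nonneg fun _ => abs_nonneg _)

/-- For finite sets `𝒳_n`, finite measures `ν_n` and probability measures `π_n` on `𝒳_n`,
`d_TV(PPP(ν_n) ⊕ π_n, PPP(ν_n)) → 0` if and only if for every `ε > 0`,
`Σ_{x∈𝒳_n} max(π_n({x}) − ε·ν_n({x}), 0) → 0`. -/
theorem dTV_PPPplus_tendsto_zero_iff
    (𝒳 : ℕ → Type*) [∀ n, Fintype (𝒳 n)] [∀ n, MeasurableSpace (𝒳 n)]
    [∀ n, DiscreteMeasurableSpace (𝒳 n)]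
    (ν : ∀ n, Measure (𝒳 n)) (hν : ∀ n, IsFiniteMeasure (ν n))
    (π : ∀ n, Measure (𝒳 n)) (hπ : ∀ n, IsProbabilityMeasure (π n)) :
    Filter.Tendsto (fun n => dTV (PPPplus (ν n) (π n)) (PPP (ν n)))
        Filter.atTop (nhds 0) ↔
      ∀ ε : ℝ, 0 < ε →
        Filter.Tendsto
          (fun n => ∑ x : 𝒳 n, max (((π n) {x}).toReal - ε * ((ν n) {x}).toReal) 0)
          Filter.atTop (nhds 0) := by
  constructor
  · intro h ε hε
    refine squeeze_zero (fun n => Finset.sum_nonneg fun x _ => le_max_right _ _)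
      (fun n => sum_max_sub_le_exp_mul_dTV (ν n) (π n) hε) ?_
    simpa using (h.const_mul 2).const_mul (Real.exp (1 / ε))
  · intro h
    rw [Metric.tendsto_nhds]
    intro δ hδ
    have hev := (h (δ ^ 2) (by positivity)).eventually (gt_mem_nhds (half_pos hδ))
    filter_upwards [hev] with n hn
    have hb := two_mul_dTV_le (ν n) (π n) (ε := δ ^ 2) (by positivity)
    rw [Real.sqrt_sq hδ.le] at hb
    rw [Real.dist_0_eq_abs, abs_of_nonneg (dTV_nonneg _ _)]
    linarith
end

section
/- For every ε > 0 and a > 0 there exists a constant D > 0 (depending only on ε and a) such that for every finite set 𝒳, every finite measure ν on 𝒳 and every probability measure π on 𝒳 with Σ_{x∈𝒳} max(π({x}) − ε·ν({x}), 0) ≥ a, one has d_TV(PPP(ν) ⊕ π, PPP(ν)) ≥ D. -/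
open MeasureTheory ProbabilityTheory

theorem measureReal_sub_le_two_mul_dTV {α : Type*} [MeasurableSpace α] [Countable α]
    [MeasurableSingletonClass α] (μ ν : Measure α) [IsFiniteMeasure μ] [IsFiniteMeasure ν]
    (A : Set α) : ν.real A - μ.real A ≤ 2 * dTV μ ν := by
  have summable_singleton (ρ : Measure α) [IsFiniteMeasure ρ] :
      Summable fun x => ρ.real {x} := by
    refine ENNReal.summable_toReal ?_
    have h := Measure.tsum_indicator_apply_singleton ρ Set.univ MeasurableSet.univ
    simp only [Set.indicator_univ] at h
    exact h ▸ measure_ne_top ρ _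
  have real_eq_tsum (ρ : Measure α) [IsFiniteMeasure ρ] :
      ρ.real A = ∑' x, A.indicator (fun x => ρ.real {x}) x := by
    rw [measureReal_def, ← Measure.tsum_indicator_apply_singleton ρ A A.to_countable.measurableSet,
      ENNReal.tsum_toReal_eq]
    · refine tsum_congr fun x => ?_
      by_cases hx : x ∈ A <;> simp [hx, measureReal_def]
    · intro x
      by_cases hx : x ∈ A <;> simp [hx]
  have hμ := summable_singleton μ
  have hν := summable_singleton ν
  have hdTV : 2 * dTV μ ν = ∑' x, |μ.real {x} - ν.real {x}| := by
    simp only [dTV, measureReal_def]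
    ring
  rw [hdTV, real_eq_tsum μ, real_eq_tsum ν, ← (hν.indicator A).tsum_sub (hμ.indicator A)]
  refine ((hν.indicator A).sub (hμ.indicator A)).tsum_le_tsum (fun x => ?_) (hμ.sub hν).abs
  by_cases hx : x ∈ A
  · simpa [hx, abs_sub_comm] using le_abs_self (ν.real {x} - μ.real {x})
  · simp [hx]

instance {𝒳 : Type*} [Fintype 𝒳] [MeasurableSpace 𝒳] (ν : Measure 𝒳) :
    IsProbabilityMeasure (PPP ν) := by
  unfold PPP
  infer_instance

/-- The void probabilities of a Poisson point process. -/
theorem PPP_real_forall_mem_eq_zero {𝒳 : Type*} [Fintype 𝒳] [MeasurableSpace 𝒳]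
    (ν : Measure 𝒳) (S : Finset 𝒳) :
    (PPP ν).real {n | ∀ x ∈ S, n x = 0} = Real.exp (-∑ x ∈ S, (ν {x}).toReal) := by
  classical
  have hset : {n : 𝒳 → ℕ | ∀ x ∈ S, n x = 0} =
      Set.univ.pi fun x => if x ∈ S then {0} else Set.univ := by
    ext n
    simp only [Set.mem_ofPred_eq, Set.mem_pi, Set.mem_univ, true_implies]
    refine forall_congr' fun x => ?_
    by_cases hx : x ∈ S <;> simp [hx]
  rw [hset, PPP, measureReal_def, Measure.pi_pi, ENNReal.toReal_prod, ← Finset.sum_neg_distrib,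
    Real.exp_sum, ← Finset.prod_subset (Finset.subset_univ S)]
  · refine Finset.prod_congr rfl fun x hx => ?_
    rw [if_pos hx, ← measureReal_def, poissonMeasure_real_singleton]
    simp [ENNReal.toReal]
  · intro x _ hx
    simp [hx]

theorem PPPplus_real_forall_mem_eq_zero {𝒳 : Type*} [Fintype 𝒳] [MeasurableSpace 𝒳]
    [DiscreteMeasurableSpace 𝒳] (ν π : Measure 𝒳) [SFinite π] (S : Finset 𝒳) :
    (PPPplus ν π).real {n | ∀ x ∈ S, n x = 0} =
      Real.exp (-∑ x ∈ S, (ν {x}).toReal) * π.real (S : Set 𝒳)ᶜ := by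
  classical
  rw [PPPplus, map_measureReal_apply Measurable.of_discrete (Set.to_countable _).measurableSet,
    ← PPP_real_forall_mem_eq_zero, ← measureReal_prod_prod]
  congr 1
  ext ⟨n, y⟩
  simp only [Set.mem_preimage, Set.mem_ofPred_eq, Set.mem_prod, Set.mem_compl_iff,
    Finset.mem_coe, Nat.add_eq_zero_iff]
  grind

/-- For every `ε > 0` and `a > 0` there is `D > 0` such that for every finite set `𝒳`,
finite measure `ν` and probability measure `π` on `𝒳` with
`Σ_{x∈𝒳} max(π({x}) − ε·ν({x}), 0) ≥ a`, one has `d_TV(PPP(ν) ⊕ π, PPP(ν)) ≥ D`. -/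
theorem dTV_PPPplus_lower_bound
    (ε a : ℝ) (hε : 0 < ε) (ha : 0 < a) :
    ∃ D : ℝ, 0 < D ∧
      ∀ (𝒳 : Type) (_ : Fintype 𝒳) (_ : MeasurableSpace 𝒳) (_ : DiscreteMeasurableSpace 𝒳)
        (ν : Measure 𝒳) (_ : IsFiniteMeasure ν)
        (π : Measure 𝒳) (_ : IsProbabilityMeasure π),
        a ≤ ∑ x : 𝒳, max ((π {x}).toReal - ε * (ν {x}).toReal) 0 →
        D ≤ dTV (PPPplus ν π) (PPP ν) := by
  refine ⟨a * Real.exp (-(1 / ε)) / 2, by positivity, ?_⟩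
  intro 𝒳 _ _ _ ν _ π _ h
  classical
  set S : Finset 𝒳 := {x | ε * (ν {x}).toReal < (π {x}).toReal} with hS
  have hπ : π.real S = ∑ x ∈ S, (π {x}).toReal := (sum_measureReal_singleton S).symm
  have hπ_ge : a ≤ π.real S := by
    refine h.trans ?_
    rw [hπ, hS, Finset.sum_filter]
    refine Finset.sum_le_sum fun x _ => ?_
    have hν := mul_nonneg hε.le (ENNReal.toReal_nonneg (a := ν {x}))
    have hx := ENNReal.toReal_nonneg (a := π {x})
    split_ifs with hlt
    · exact max_le (by linarith) hx
    · exact max_le (by linarith) le_rfl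
  have hν_le : ∑ x ∈ S, (ν {x}).toReal ≤ 1 / ε := by
    rw [le_div_iff₀' hε, Finset.mul_sum]
    calc ∑ x ∈ S, ε * (ν {x}).toReal ≤ ∑ x ∈ S, (π {x}).toReal :=
          Finset.sum_le_sum fun x hx => (Finset.mem_filter.1 hx).2.le
      _ = π.real S := hπ.symm
      _ ≤ 1 := measureReal_le_one
  have : IsFiniteMeasure (PPPplus ν π) := by
    unfold PPPplus
    infer_instance
  have key := measureReal_sub_le_two_mul_dTV (PPPplus ν π) (PPP ν) {n | ∀ x ∈ S, n x = 0}
  rw [PPPplus_real_forall_mem_eq_zero, PPP_real_forall_mem_eq_zero,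
    probReal_compl_eq_one_sub S.measurableSet] at key
  have hexp : Real.exp (-(1 / ε)) ≤ Real.exp (-∑ x ∈ S, (ν {x}).toReal) :=
    Real.exp_le_exp.2 (neg_le_neg hν_le)
  have hmul := mul_le_mul hπ_ge hexp (Real.exp_pos _).le (ha.le.trans hπ_ge)
  linarith
end

section
/- For every ε > 0 and a > 0, the infimum of d_TV(Poi(λ) * Ber(p), Poi(λ)) over all λ ≥ 0 and p ∈ [0,1] satisfying ε·λ + a ≤ p is strictly positive; i.e. there exists D_{ε,a} > 0 such that d_TV(Poi(λ) * Ber(p), Poi(λ)) ≥ D_{ε,a} whenever λ ≥ 0, p ∈ [0,1] and ε·λ + a ≤ p. -/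
open MeasureTheory ProbabilityTheory

/-- The Bernoulli distribution with parameter `p`, as a measure on `ℕ` supported
on `{0,1}`. -/
noncomputable def bernoulliNat (p : ℝ) : Measure ℕ :=
  ENNReal.ofReal (1 - p) • Measure.dirac 0 + ENNReal.ofReal p • Measure.dirac 1

/-- `Poi(λ) * Ber(p)`: the law of the sum of independent `Poisson(λ)` and `Bernoulli(p)`
random variables. -/
noncomputable def poissonConvBernoulli (l : NNReal) (p : ℝ) : Measure ℕ :=
  ((poissonMeasure l).prod (bernoulliNat p)).map (fun q => q.1 + q.2)

instance (p : ℝ) : IsFiniteMeasure (bernoulliNat p) := by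
  refine ⟨?_⟩
  simp [bernoulliNat]

instance (l : NNReal) (p : ℝ) : IsFiniteMeasure (poissonConvBernoulli l p) := by
  unfold poissonConvBernoulli
  infer_instance

lemma summable_toReal_singleton (μ : Measure ℕ) [IsFiniteMeasure μ] :
    Summable fun x : ℕ => (μ {x}).toReal := by
  refine ENNReal.summable_toReal ?_
  rw [← measure_iUnion (fun i j hij => by simpa using hij) fun i => measurableSet_singleton i]
  exact measure_ne_top _ _

lemma half_abs_singleton_le_dTV (μ ν : Measure ℕ) [IsFiniteMeasure μ] [IsFiniteMeasure ν] (n : ℕ) :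
    (1 / 2) * |(μ {n}).toReal - (ν {n}).toReal| ≤ dTV μ ν := by
  have h := (((summable_toReal_singleton μ).sub (summable_toReal_singleton ν)).abs).le_tsum n
    fun j _ => abs_nonneg _
  exact mul_le_mul_of_nonneg_left h (by norm_num)

lemma poissonConvBernoulli_singleton_zero (l : NNReal) {p : ℝ} (hp : p ≤ 1) :
    (poissonConvBernoulli l p {0}).toReal = Real.exp (-l) * (1 - p) := by
  have hpre : (fun q : ℕ × ℕ => q.1 + q.2) ⁻¹' {0} = {0} ×ˢ {0} := by
    ext ⟨x, y⟩
    simp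
  rw [poissonConvBernoulli, Measure.map_apply (by fun_prop) (measurableSet_singleton 0), hpre,
    Measure.prod_prod, ENNReal.toReal_mul]
  simp [bernoulliNat, poissonMeasure_singleton, ENNReal.toReal_ofReal, Real.exp_nonneg, hp]

/-- For every `ε > 0` and `a > 0`, the infimum of `d_TV(Poi(λ) * Ber(p), Poi(λ))` over all
`λ ≥ 0` and `p ∈ [0,1]` with `ε·λ + a ≤ p` is strictly positive: there exists `D > 0` such
that `d_TV(Poi(λ) * Ber(p), Poi(λ)) ≥ D` whenever `λ ≥ 0`, `p ∈ [0,1]` and `ε·λ + a ≤ p`. -/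
theorem dTV_poisson_conv_bernoulli_lower_bound
    (ε a : ℝ) (hε : 0 < ε) (ha : 0 < a) :
    ∃ D : ℝ, 0 < D ∧
      ∀ (l : NNReal) (p : ℝ), 0 ≤ p → p ≤ 1 → ε * (l : ℝ) + a ≤ p →
        D ≤ dTV (poissonConvBernoulli l p) (poissonMeasure l) := by
  refine ⟨1 / 2 * (Real.exp (-(1 / ε)) * a), by positivity, fun l p hp0 hp1 h => ?_⟩
  refine le_trans ?_ (half_abs_singleton_le_dTV _ _ 0)
  have hl : (l : ℝ) ≤ 1 / ε := by
    rw [le_div_iff₀ hε]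
    linarith
  have hap : a ≤ p := le_trans (le_add_of_nonneg_left (by positivity)) h
  have hpoisson : (poissonMeasure l {0}).toReal = Real.exp (-l) := by
    simp [poissonMeasure_singleton, ENNReal.toReal_ofReal, Real.exp_nonneg]
  have hdiff : Real.exp (-(l : ℝ)) * (1 - p) - Real.exp (-l) = -(Real.exp (-l) * p) := by ring
  rw [poissonConvBernoulli_singleton_zero l hp1, hpoisson, hdiff, abs_neg,
    abs_of_nonneg (by positivity)]
  gcongr
end

section
/- For all finite vertex sets K ⊆ L ⊆ V and every y ∈ V: Σ_{x∈L} e_L(x) · P_x[τ_K < ∞ and X_{τ_K} = y] = e_K(y). -/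
open MeasureTheory Filter

section Setup

variable {V : Type*} [MeasurableSpace V]

/-- Total weight at a vertex: `a_x = Σ_{z∼x} a_{x,z}`. -/
noncomputable def aTot (G : SimpleGraph V) [G.LocallyFinite] (a : V → V → ℝ) (x : V) : ℝ :=
  ∑ z ∈ G.neighborFinset x, a x z

open Classical in
/-- Transition probabilities of the weighted random walk:
`p(x,y) = a_{x,y}/a_x` for edges and `0` otherwise. -/
noncomputable def step (G : SimpleGraph V) [G.LocallyFinite] (a : V → V → ℝ) (x y : V) : ℝ :=
  if G.Adj x y then a x y / aTot G a x else 0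

/-- The event `{τ_K^+ = ∞}`: the walk never returns to `K` at a time `n ≥ 1`. -/
def noReturn (K : Set V) : Set (ℕ → V) := {w | ∀ n ≥ 1, w n ∉ K}

/-- The event `{τ_K < ∞}`: the walk hits `K`. -/
def hits (K : Set V) : Set (ℕ → V) := {w | ∃ n, w n ∈ K}

/-- The event `{τ_K < ∞ and X_{τ_K} = y}`: the walk hits `K`, entering it at `y`. -/
def hitsAt (K : Set V) (y : V) : Set (ℕ → V) :=
  {w | (∃ n, w n ∈ K) ∧ w (sInf {n | w n ∈ K}) = y}

/-- The event `{λ_K < ∞ and X_{λ_K} = y}`: the walk visits `K`, finitely often,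
and its last visit to `K` is at `y`. -/
def lastVisitAt (K : Set V) (y : V) : Set (ℕ → V) :=
  {w | (∃ n, w n ∈ K) ∧ {n | w n ∈ K}.Finite ∧ w (sSup {n | w n ∈ K}) = y}

open Classical in
/-- The equilibrium measure of a finite vertex set `K`:
`e_K(x) = a_x · P_x[τ_K^+ = ∞]` for `x ∈ K`, and `0` otherwise. -/
noncomputable def equil (G : SimpleGraph V) [G.LocallyFinite] (a : V → V → ℝ)
    (P : V → Measure (ℕ → V)) (K : Finset V) (x : V) : ℝ :=
  if x ∈ K then aTot G a x * ((P x) (noReturn (K : Set V))).toReal else 0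

/-- The capacity of a finite vertex set `K`: `cap(K) = Σ_{x∈K} e_K(x)`. -/
noncomputable def capa (G : SimpleGraph V) [G.LocallyFinite] (a : V → V → ℝ)
    (P : V → Measure (ℕ → V)) (K : Finset V) : ℝ :=
  ∑ x ∈ K, equil G a P K x

/-- The harmonic measure of a nonempty finite vertex set `K`: `harm_K = e_K / cap(K)`. -/
noncomputable def harm (G : SimpleGraph V) [G.LocallyFinite] (a : V → V → ℝ)
    (P : V → Measure (ℕ → V)) (K : Finset V) (x : V) : ℝ :=
  equil G a P K x / capa G a P K

end Setup

open scoped ENNReal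

section PathWeights

variable {V : Type*}

/-- Weight of the paths of length `n` from `y` to `x` whose steps all land in `S`. -/
noncomputable def landWeight (p : V → V → ℝ≥0∞) (S : Set V) : ℕ → V → V → ℝ≥0∞
  | 0, y, x => Set.indicator {x} 1 y
  | n + 1, y, x => ∑' z, p y z * (S.indicator 1 z * landWeight p S n z x)

/-- Weight of the paths of length `n` from `x` to `y` whose steps all depart from `S`. -/
noncomputable def departWeight (p : V → V → ℝ≥0∞) (S : Set V) : ℕ → V → V → ℝ≥0∞
  | 0, x, y => Set.indicator {y} 1 x
  | n + 1, x, y => S.indicator 1 x * ∑' z, p x z * departWeight p S n z y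


theorem landWeight_succ_last (p : V → V → ℝ≥0∞) (S : Set V) (n : ℕ) (y x : V) :
    landWeight p S (n + 1) y x = (∑' z, landWeight p S n y z * p z x) * S.indicator 1 x := by
  induction n generalizing y with
  | zero =>
    rw [landWeight, tsum_eq_single x, tsum_eq_single y]
    · simp [landWeight]
    · intro z hz
      simp [landWeight, hz.symm]
    · intro z hz
      simp [landWeight, hz]
  | succ n ih =>
    rw [landWeight]
    simp_rw [ih]
    simp only [landWeight, ← ENNReal.tsum_mul_right, ← ENNReal.tsum_mul_left]
    rw [ENNReal.tsum_comm]
    refine tsum_congr fun u => tsum_congr fun z => ?_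
    ring

/-- Time reversal for path weights of a chain with reversing measure `m`. -/
theorem mul_departWeight_eq_mul_landWeight {p : V → V → ℝ≥0∞} {m : V → ℝ≥0∞}
    (hrev : ∀ x y, m x * p x y = m y * p y x) (S : Set V) (n : ℕ) (x y : V) :
    m x * departWeight p S n x y = m y * landWeight p S n y x := by
  induction n generalizing x with
  | zero =>
    by_cases h : x = y
    · simp [departWeight, landWeight, h]
    · simp [departWeight, landWeight, h, Ne.symm h]
  | succ n ih =>
    rw [departWeight, landWeight_succ_last, mul_left_comm, mul_comm (∑' z, _) (S.indicator 1 x),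
      mul_left_comm (m y)]
    congr 1
    rw [← ENNReal.tsum_mul_left, ← ENNReal.tsum_mul_left]
    refine tsum_congr fun z => ?_
    rw [← mul_assoc, hrev, mul_right_comm, ih]
    ring

end PathWeights

section MarkovChain

variable {V : Type*} [MeasurableSpace V]

theorem measurable_eval_pred [DiscreteMeasurableSpace V] (q : V → Prop) (n : ℕ) :
    Measurable fun w : ℕ → V => q (w n) :=
  (Measurable.of_discrete (f := q)).comp (measurable_pi_apply n)

theorem measure_ext_of_initial_segments [Countable V] [DiscreteMeasurableSpace V]
    {μ ν : Measure (ℕ → V)} [IsFiniteMeasure μ]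
    (h : ∀ (n : ℕ) (c : ℕ → V), μ {w | ∀ i ≤ n, w i = c i} = ν {w | ∀ i ≤ n, w i = c i}) :
    μ = ν := by
  cases isEmpty_or_nonempty V with
  | inl hV =>
    refine Measure.ext fun s _ => ?_
    rw [Set.eq_empty_of_isEmpty s, measure_empty, measure_empty]
  | inr hV =>
    inhabit V
    have hmap : ∀ n, μ.map (Preorder.frestrictLe (π := fun _ => V) n) =
        ν.map (Preorder.frestrictLe n) := by
      intro n
      refine Measure.ext_of_singleton fun c => ?_
      rw [Measure.map_apply (Preorder.measurable_frestrictLe n) (measurableSet_singleton c),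
        Measure.map_apply (Preorder.measurable_frestrictLe n) (measurableSet_singleton c)]
      have hset : Preorder.frestrictLe (π := fun _ => V) n ⁻¹' {c} =
          {w | ∀ i ≤ n, w i = if hi : i ≤ n then c ⟨i, Finset.mem_Iic.2 hi⟩ else default} := by
        ext w
        simp only [Set.mem_preimage, Set.mem_singleton_iff, Set.mem_ofPred_eq, funext_iff,
          Subtype.forall, Finset.mem_Iic]
        refine forall₂_congr fun i hi => ?_
        simp [hi]
      rw [hset, h]
    have hμ : IsProjectiveLimit μ fun I : Finset ℕ => μ.map I.restrict := fun I => rfl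
    refine hμ.unique ?_
    have hfam : IsProjectiveMeasureFamily fun I : Finset ℕ => μ.map I.restrict := by
      intro I J hJI
      rw [Measure.map_map (Finset.measurable_restrict₂ hJI) (Finset.measurable_restrict I)]
      rfl
    exact (isProjectiveLimit_nat_iff hfam ν).2 fun n => (hmap n).symm

theorem ae_start_eq [DiscreteMeasurableSpace V]
    {p : V → V → ℝ≥0∞} {P : V → Measure (ℕ → V)} (hprob : ∀ x, IsProbabilityMeasure (P x))
    (hP : ∀ (x : V) (n : ℕ) (c : ℕ → V), P x {w | ∀ i ≤ n, w i = c i} =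
      (Set.indicator {x} 1 (c 0)) * ∏ i ∈ Finset.range n, p (c i) (c (i + 1))) (x : V) :
    ∀ᵐ w ∂P x, w 0 = x := by
  have hm : MeasurableSet {w : ℕ → V | w 0 = x} :=
    measurableSet_setOfPred.2 (measurable_eval_pred (· = x) 0)
  refine (mem_ae_iff_prob_eq_one hm).2 ?_
  simpa using hP x 0 fun _ => x

theorem measure_start_and [DiscreteMeasurableSpace V]
    {p : V → V → ℝ≥0∞} {P : V → Measure (ℕ → V)} (hprob : ∀ x, IsProbabilityMeasure (P x))
    (hP : ∀ (x : V) (n : ℕ) (c : ℕ → V), P x {w | ∀ i ≤ n, w i = c i} =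
      (Set.indicator {x} 1 (c 0)) * ∏ i ∈ Finset.range n, p (c i) (c (i + 1)))
    (x : V) (S : Set V) (q : (ℕ → V) → Prop) :
    P x {w | w 0 ∈ S ∧ q w} = S.indicator 1 x * P x {w | q w} := by
  by_cases hx : x ∈ S
  · rw [Set.indicator_of_mem hx, Pi.one_apply, one_mul]
    refine measure_congr ?_
    filter_upwards [ae_start_eq hprob hP x] with w hw
    exact propext ⟨fun h => h.2, fun h => ⟨hw.symm ▸ hx, h⟩⟩
  · rw [Set.indicator_of_notMem hx, zero_mul]
    refine measure_eq_zero_iff_ae_notMem.2 ?_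
    filter_upwards [ae_start_eq hprob hP x] with w hw h
    exact hx (hw ▸ h.1)

/-- The one-step Markov property. -/
theorem measure_preimage_shift [Countable V] [DiscreteMeasurableSpace V]
    {p : V → V → ℝ≥0∞} {P : V → Measure (ℕ → V)} (hprob : ∀ x, IsProbabilityMeasure (P x))
    (hP : ∀ (x : V) (n : ℕ) (c : ℕ → V), P x {w | ∀ i ≤ n, w i = c i} =
      (Set.indicator {x} 1 (c 0)) * ∏ i ∈ Finset.range n, p (c i) (c (i + 1)))
    (x : V) {A : Set (ℕ → V)} (hA : MeasurableSet A) :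
    P x {w | (fun i => w (i + 1)) ∈ A} = ∑' z, p x z * P z A := by
  have hshift : Measurable fun (w : ℕ → V) (i : ℕ) => w (i + 1) :=
    measurable_pi_lambda _ fun i => measurable_pi_apply (i + 1)
  have hmap : (P x).map (fun (w : ℕ → V) (i : ℕ) => w (i + 1)) =
      Measure.sum fun z => p x z • P z := by
    have : IsProbabilityMeasure ((P x).map fun (w : ℕ → V) (i : ℕ) => w (i + 1)) :=
      Measure.isProbabilityMeasure_map hshift.aemeasurable
    refine measure_ext_of_initial_segments fun n c => ?_
    have hcyl : MeasurableSet {w : ℕ → V | ∀ i ≤ n, w i = c i} :=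
      measurableSet_setOfPred.2 <| .forall fun i => .forall fun _ =>
        measurable_eval_pred (· = c i) i
    rw [Measure.map_apply hshift hcyl, Measure.sum_apply _ hcyl]
    have hext : P x ((fun (w : ℕ → V) (i : ℕ) => w (i + 1)) ⁻¹' {w | ∀ i ≤ n, w i = c i}) =
        P x {w | ∀ i ≤ n + 1, w i = Nat.casesOn i x c} := by
      refine measure_congr ?_
      filter_upwards [ae_start_eq hprob hP x] with w hw
      refine propext ⟨fun h i hi => ?_, fun h i hi => h (i + 1) (by omega)⟩
      cases i with
      | zero => exact hw
      | succ i => exact h i (by omega)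
    rw [hext, hP, Finset.prod_range_succ', tsum_eq_single (c 0)]
    · simp [hP, mul_comm]
    · intro z hz
      simp [hP, hz.symm]
  have hApply := congrArg (fun μ => μ A) hmap
  simp only [Measure.map_apply hshift hA, Measure.sum_apply _ hA, Measure.smul_apply,
    smul_eq_mul] at hApply
  exact hApply

variable [Countable V] [DiscreteMeasurableSpace V]
  {p : V → V → ℝ≥0∞} {P : V → Measure (ℕ → V)}

/-- The Markov property at time `n` on the event that the chain stays in `S` at times
`1, …, n`. -/
theorem measure_land_and (hprob : ∀ x, IsProbabilityMeasure (P x))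
    (hP : ∀ (x : V) (n : ℕ) (c : ℕ → V), P x {w | ∀ i ≤ n, w i = c i} =
      (Set.indicator {x} 1 (c 0)) * ∏ i ∈ Finset.range n, p (c i) (c (i + 1)))
    (S : Set V) {A : Set (ℕ → V)} (hA : MeasurableSet A) (n : ℕ) (y x : V) :
    P y {w | (∀ i < n, w (i + 1) ∈ S) ∧ w n = x ∧ (fun i => w (i + n)) ∈ A} =
      landWeight p S n y x * P x A := by
  induction n generalizing y with
  | zero =>
    have h := measure_start_and hprob hP y {x} (· ∈ A)
    simp only [Set.mem_singleton_iff] at h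
    simp only [not_lt_zero, IsEmpty.forall_iff, implies_true, true_and, add_zero, h, landWeight]
    by_cases hyx : y = x
    · subst hyx
      rfl
    · simp [hyx]
  | succ n ih =>
    have hmeas : MeasurableSet {w : ℕ → V | w 0 ∈ S ∧ (∀ i < n, w (i + 1) ∈ S) ∧ w n = x ∧
        (fun i => w (i + n)) ∈ A} := by
      have hshift : Measurable fun (w : ℕ → V) (i : ℕ) => w (i + n) :=
        measurable_pi_lambda _ fun i => measurable_pi_apply (i + n)
      exact measurableSet_setOfPred.2 <| (measurable_eval_pred (· ∈ S) 0).and <|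
        (Measurable.forall fun i => .forall fun _ => measurable_eval_pred (· ∈ S) (i + 1)).and <|
        (measurable_eval_pred (· = x) n).and <| measurableSet_setOfPred.1 (hshift hA)
    have hset : {w : ℕ → V | (∀ i < n + 1, w (i + 1) ∈ S) ∧ w (n + 1) = x ∧
          (fun i => w (i + (n + 1))) ∈ A} =
        {w | (fun i => w (i + 1)) ∈ {w : ℕ → V | w 0 ∈ S ∧ (∀ i < n, w (i + 1) ∈ S) ∧
          w n = x ∧ (fun i => w (i + n)) ∈ A}} := by
      ext w
      simp only [Set.mem_ofPred_eq, Nat.forall_lt_succ_left, and_assoc, zero_add]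
      rfl
    rw [hset, measure_preimage_shift hprob hP y hmeas, landWeight, ← ENNReal.tsum_mul_right]
    refine tsum_congr fun z => ?_
    rw [measure_start_and hprob hP, ih]
    ring

theorem measure_depart (hprob : ∀ x, IsProbabilityMeasure (P x))
    (hP : ∀ (x : V) (n : ℕ) (c : ℕ → V), P x {w | ∀ i ≤ n, w i = c i} =
      (Set.indicator {x} 1 (c 0)) * ∏ i ∈ Finset.range n, p (c i) (c (i + 1)))
    (S : Set V) (n : ℕ) (x y : V) :
    P x {w | (∀ i < n, w i ∈ S) ∧ w n = y} = departWeight p S n x y := by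
  induction n generalizing x with
  | zero =>
    have h := measure_start_and hprob hP x {y} fun _ => True
    simpa [departWeight] using h
  | succ n ih =>
    have hmeas : MeasurableSet {w : ℕ → V | (∀ i < n, w i ∈ S) ∧ w n = y} :=
      measurableSet_setOfPred.2 <|
        (Measurable.forall fun i => .forall fun _ => measurable_eval_pred (· ∈ S) i).and <|
        measurable_eval_pred (· = y) n
    simp only [Nat.forall_lt_succ_left, and_assoc]
    rw [measure_start_and hprob hP, departWeight]
    congr 1
    simp_rw [← ih]
    exact measure_preimage_shift hprob hP x hmeas

/-- First-entrance decomposition of the hitting probability. -/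
theorem measure_hitsAt (hprob : ∀ x, IsProbabilityMeasure (P x))
    (hP : ∀ (x : V) (n : ℕ) (c : ℕ → V), P x {w | ∀ i ≤ n, w i = c i} =
      (Set.indicator {x} 1 (c 0)) * ∏ i ∈ Finset.range n, p (c i) (c (i + 1)))
    {K : Set V} {y : V} (hy : y ∈ K) (x : V) :
    P x (hitsAt K y) = ∑' n, departWeight p Kᶜ n x y := by
  have hset : hitsAt K y = ⋃ n, {w : ℕ → V | (∀ i < n, w i ∈ Kᶜ) ∧ w n = y} := by
    ext w
    simp only [hitsAt, Set.mem_ofPred_eq, Set.mem_iUnion, Set.mem_compl_iff]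
    constructor
    · rintro ⟨-, h⟩
      exact ⟨_, fun i hi => Nat.notMem_of_lt_sInf hi, h⟩
    · rintro ⟨n, hn, h⟩
      have hnK : w n ∈ K := h.symm ▸ hy
      refine ⟨⟨n, hnK⟩, ?_⟩
      have hinf : sInf {n | w n ∈ K} = n := by
        refine le_antisymm (Nat.sInf_le hnK) (not_lt.1 fun hlt => hn _ hlt ?_)
        exact Nat.sInf_mem (s := {n | w n ∈ K}) ⟨n, hnK⟩
      rw [hinf, h]
  rw [hset, measure_iUnion]
  · exact tsum_congr fun n => measure_depart hprob hP _ n x y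
  · intro m n hmn
    refine Set.disjoint_left.2 ?_
    rintro w ⟨h₁, h₂⟩ ⟨h₃, h₄⟩
    rcases hmn.lt_or_gt with h | h
    · exact h₃ m h (h₂.symm ▸ hy)
    · exact h₁ n h (h₄.symm ▸ hy)
  · intro n
    exact measurableSet_setOfPred.2 <|
      (Measurable.forall fun i => .forall fun _ => measurable_eval_pred (· ∈ Kᶜ) i).and <|
      measurable_eval_pred (· = y) n

/-- Last-exit decomposition of the escape probability. -/
theorem measure_noReturn (hprob : ∀ x, IsProbabilityMeasure (P x))
    (hP : ∀ (x : V) (n : ℕ) (c : ℕ → V), P x {w | ∀ i ≤ n, w i = c i} =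
      (Set.indicator {x} 1 (c 0)) * ∏ i ∈ Finset.range n, p (c i) (c (i + 1)))
    (htrans : ∀ x y : V, ∀ᵐ w ∂P x, {n : ℕ | w n = y}.Finite)
    {K L : Finset V} (hKL : K ⊆ L) {y : V} (hy : y ∈ K) :
    P y (noReturn (K : Set V)) =
      ∑ x ∈ L, (∑' n, landWeight p (K : Set V)ᶜ n y x) * P x (noReturn (L : Set V)) := by
  have hNR : MeasurableSet (noReturn (L : Set V)) :=
    measurableSet_setOfPred.2 <| .forall fun i => .forall fun _ =>
      measurable_eval_pred (· ∉ (L : Set V)) i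
  have hae : P y (noReturn (K : Set V)) = P y (⋃ q : L × ℕ, {w : ℕ → V |
      (∀ i < q.2, w (i + 1) ∈ (K : Set V)ᶜ) ∧ w q.2 = q.1 ∧
        (fun i => w (i + q.2)) ∈ noReturn (L : Set V)}) := by
    refine measure_congr ?_
    filter_upwards [ae_start_eq hprob hP y, ae_all_iff.2 fun x => htrans y x] with w hw hfin
    refine propext ?_
    change w ∈ noReturn (K : Set V) ↔ w ∈ ⋃ q : L × ℕ, _
    simp only [noReturn, Set.mem_iUnion, Set.mem_ofPred_eq, Set.mem_compl_iff, Finset.mem_coe]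
    constructor
    · intro h
      have hfinL : {n | w n ∈ L}.Finite := by
        refine (L.finite_toSet.biUnion fun x _ => hfin x).subset fun n hn => ?_
        exact Set.mem_biUnion hn rfl
      have hne : {n | w n ∈ L}.Nonempty := ⟨0, by simpa [hw] using hKL hy⟩
      obtain ⟨n, hn, hmax⟩ := hfinL.exists_maximal hne
      refine ⟨(⟨w n, hn⟩, n), fun i _ => h _ (by omega), rfl, fun i hi hiL => ?_⟩
      have := hmax (y := i + n) hiL (Nat.le_add_left n i)
      omega
    · rintro ⟨⟨x, n⟩, h₁, -, h₃⟩ i hi hiK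
      by_cases hin : i ≤ n
      · refine h₁ (i - 1) (show i - 1 < n by omega) ?_
        rwa [Nat.sub_add_cancel hi]
      · refine h₃ (i - n) (by omega) (hKL ?_)
        dsimp only
        rwa [Nat.sub_add_cancel (by omega)]
  rw [hae, measure_iUnion, ENNReal.tsum_prod', tsum_fintype, ← Finset.sum_coe_sort L]
  · refine Finset.sum_congr rfl fun x _ => ?_
    rw [← ENNReal.tsum_mul_right]
    exact tsum_congr fun n => measure_land_and hprob hP _ hNR n y x
  · rintro ⟨x, m⟩ ⟨z, n⟩ hne
    refine Set.disjoint_left.2 ?_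
    rintro w ⟨-, h₁, h₂⟩ ⟨-, h₃, h₄⟩
    dsimp only at h₁ h₂ h₃ h₄
    rcases lt_trichotomy m n with h | rfl | h
    · refine h₂ (n - m) (by omega) ?_
      dsimp only
      rw [Nat.sub_add_cancel h.le, h₃]
      exact z.2
    · exact hne (Prod.ext (Subtype.ext (h₁.symm.trans h₃)) rfl)
    · refine h₄ (m - n) (by omega) ?_
      dsimp only
      rw [Nat.sub_add_cancel h.le, h₁]
      exact x.2
  · rintro ⟨x, n⟩
    have hshift : Measurable fun (w : ℕ → V) (i : ℕ) => w (i + n) :=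
      measurable_pi_lambda _ fun i => measurable_pi_apply (i + n)
    exact measurableSet_setOfPred.2 <|
      (Measurable.forall fun i => .forall fun _ =>
        measurable_eval_pred (· ∈ (K : Set V)ᶜ) (i + 1)).and <|
      (measurable_eval_pred (· = (x : V)) n).and <| measurableSet_setOfPred.1 (hshift hNR)

/-- Consistency of escape measures for a transient chain with reversing measure `m`. -/
theorem sum_escape_mul_hitsAt (hprob : ∀ x, IsProbabilityMeasure (P x))
    (hP : ∀ (x : V) (n : ℕ) (c : ℕ → V), P x {w | ∀ i ≤ n, w i = c i} =
      (Set.indicator {x} 1 (c 0)) * ∏ i ∈ Finset.range n, p (c i) (c (i + 1)))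
    (htrans : ∀ x y : V, ∀ᵐ w ∂P x, {n : ℕ | w n = y}.Finite)
    {m : V → ℝ≥0∞} (hrev : ∀ x y, m x * p x y = m y * p y x)
    {K L : Finset V} (hKL : K ⊆ L) {y : V} (hy : y ∈ K) :
    ∑ x ∈ L, m x * P x (noReturn (L : Set V)) * P x (hitsAt (K : Set V) y) =
      m y * P y (noReturn (K : Set V)) := by
  rw [measure_noReturn hprob hP htrans hKL hy, Finset.mul_sum]
  refine Finset.sum_congr rfl fun x _ => ?_
  rw [measure_hitsAt hprob hP (Finset.mem_coe.2 hy), mul_right_comm, ← mul_assoc,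
    ← ENNReal.tsum_mul_left, ← ENNReal.tsum_mul_left]
  simp_rw [mul_departWeight_eq_mul_landWeight hrev]

end MarkovChain

section Conductances

variable {V : Type*} (G : SimpleGraph V) [G.LocallyFinite] {a : V → V → ℝ}

theorem aTot_nonneg (hpos : ∀ x y, G.Adj x y → 0 < a x y) (x : V) : 0 ≤ aTot G a x :=
  Finset.sum_nonneg fun z hz => (hpos x z ((G.mem_neighborFinset x z).1 hz)).le

theorem aTot_mul_step (hpos : ∀ x y, G.Adj x y → 0 < a x y) {x y : V} (h : G.Adj x y) :
    aTot G a x * step G a x y = a x y := by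
  have hne : aTot G a x ≠ 0 :=
    (Finset.sum_pos (fun z hz => hpos x z ((G.mem_neighborFinset x z).1 hz))
      ⟨y, (G.mem_neighborFinset x y).2 h⟩).ne'
  rw [step, if_pos h, mul_div_cancel₀ _ hne]

theorem aTot_mul_step_comm (hsymm : ∀ x y, a x y = a y x)
    (hpos : ∀ x y, G.Adj x y → 0 < a x y) (x y : V) :
    aTot G a x * step G a x y = aTot G a y * step G a y x := by
  by_cases h : G.Adj x y
  · rw [aTot_mul_step G hpos h, aTot_mul_step G hpos h.symm, hsymm]
  · simp [step, h, G.adj_comm y x]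

end Conductances

open ProbabilityTheory in
open Classical in
/-- Consistency of equilibrium measures: for finite vertex sets `K ⊆ L` and any `y`,
`Σ_{x∈L} e_L(x) · P_x[τ_K < ∞, X_{τ_K} = y] = e_K(y)`. -/
theorem equilibrium_consistency
    {V : Type*} [Countable V] [MeasurableSpace V] [DiscreteMeasurableSpace V]
    (G : SimpleGraph V) [G.LocallyFinite] (hconn : G.Connected)
    (a : V → V → ℝ)
    (hsymm : ∀ x y, a x y = a y x)
    (hpos : ∀ x y, G.Adj x y → 0 < a x y)
    (P : V → Measure (ℕ → V)) (hprob : ∀ x, IsProbabilityMeasure (P x))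
    (hP : ∀ (x : V) (n : ℕ) (c : ℕ → V),
      P x {w | ∀ i ≤ n, w i = c i} =
        (if c 0 = x then 1 else 0) *
          ∏ i ∈ Finset.range n, ENNReal.ofReal (step G a (c i) (c (i + 1))))
    (htrans : ∀ x y : V, ∀ᵐ w ∂ P x, {n : ℕ | w n = y}.Finite)
    (K L : Finset V) (hKL : K ⊆ L) (y : V) :
    ∑ x ∈ L, equil G a P L x * ((P x) (hitsAt (K : Set V) y)).toReal = equil G a P K y := by
  by_cases hy : y ∈ K
  · have hcyl : ∀ (x : V) (n : ℕ) (c : ℕ → V), P x {w | ∀ i ≤ n, w i = c i} =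
        (Set.indicator {x} 1 (c 0)) *
          ∏ i ∈ Finset.range n, (fun u v => ENNReal.ofReal (step G a u v)) (c i) (c (i + 1)) := by
      intro x n c
      rw [hP]
      simp only [Set.indicator_apply, Set.mem_singleton_iff, Pi.one_apply]
    have hrev : ∀ x z : V, ENNReal.ofReal (aTot G a x) * ENNReal.ofReal (step G a x z) =
        ENNReal.ofReal (aTot G a z) * ENNReal.ofReal (step G a z x) := by
      intro x z
      rw [← ENNReal.ofReal_mul (aTot_nonneg G hpos x), ← ENNReal.ofReal_mul (aTot_nonneg G hpos z),
        aTot_mul_step_comm G hsymm hpos]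
    have hmain := congrArg ENNReal.toReal
      (sum_escape_mul_hitsAt hprob hcyl htrans hrev hKL hy)
    rw [ENNReal.toReal_sum fun x _ => ENNReal.mul_ne_top
      (ENNReal.mul_ne_top ENNReal.ofReal_ne_top (measure_ne_top _ _)) (measure_ne_top _ _)] at hmain
    simp only [ENNReal.toReal_mul, ENNReal.toReal_ofReal (aTot_nonneg G hpos _)] at hmain
    rw [equil, if_pos hy, ← hmain]
    exact Finset.sum_congr rfl fun x hx => by rw [equil, if_pos hx]
  · have hempty : hitsAt (K : Set V) y = ∅ := by
      refine Set.eq_empty_of_forall_notMem ?_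
      rintro w ⟨hne, rfl⟩
      exact hy (Nat.sInf_mem (s := {n | w n ∈ (K : Set V)}) hne)
    simp [hempty, equil, hy]
end
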